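/- Let Q be an irreducible negative definite root lattice of rank at most 9 (i.e. isometric to one of Aₙ with n ≤ 9, Dₙ with 4 ≤ n ≤ 9, E₆, E₇, E₈). For i = 1, 2 let Cᵢ ⊆ Q be a connected ADE configuration of roots: a linearly independent set of vectors of square −2 with pairwise products in {0, 1}, whose graph (edges between elements with nonzero product) is connected. Let Qᵢ be the sublattice spanned by Cᵢ and Qᵢ' = (Qᵢ ⊗ ℚ) ∩ Q its primitive closure in Q. Assume Q₁ ≅ Q₂ and Q₁' ≅ Q₂', and that one of the following holds: (1) Q₁ = Q; (2) Q₁ ≠ Q₁' = Q; (3) Q₁ ≅ A₇, Q₁' ≅ E₇ and Q ≅ E₈; (4) Q₁ ≅ A₈ and Q ≅ A₉; (5) Q₁ ≅ A₈ and Q ≅ D₉. Then there is an element w of the Weyl group W(Q) with w(C₁) = C₂. -/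

import Mathlib

open Matrix

/-- The Gram matrix of the `Aₙ` root lattice (a chain of `n` nodes). -/
def aGram (n : ℕ) : Matrix (Fin n) (Fin n) ℤ :=
  Matrix.of fun i j =>
    if i = j then -2 else if i.val + 1 = j.val ∨ j.val + 1 = i.val then 1 else 0

/-- The Gram matrix of the `Dₙ` root lattice: node `0` attached to node `2`, and
nodes `1, 2, …, n-1` forming a chain. -/
def dGram (n : ℕ) : Matrix (Fin n) (Fin n) ℤ :=
  Matrix.of fun i j =>
    if i = j then -2
    else if (i.val = 0 ∧ j.val = 2) ∨ (j.val = 0 ∧ i.val = 2) then 1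
    else if (1 ≤ i.val ∧ i.val + 1 = j.val) ∨ (1 ≤ j.val ∧ j.val + 1 = i.val) then 1
    else 0

/-- The Gram matrix of the `Eₙ` root lattice (`n = 6, 7, 8`): nodes `0, …, n-2` form a
chain and node `n-1` is attached to node `n-4`. -/
def eGram (n : ℕ) : Matrix (Fin n) (Fin n) ℤ :=
  Matrix.of fun i j =>
    if i = j then -2
    else if (i.val + 1 = j.val ∧ j.val ≤ n - 2) ∨ (j.val + 1 = i.val ∧ i.val ≤ n - 2)
      then 1
    else if (i.val = n - 1 ∧ j.val = n - 4) ∨ (j.val = n - 1 ∧ i.val = n - 4) then 1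
    else 0

/-- The sublattice `S` of the lattice `(M, D)` is isometric to the lattice with Gram
matrix `G`. -/
def IsoToGram {M : Type*} [AddCommGroup M] [Module ℤ M]
    (D : M →ₗ[ℤ] M →ₗ[ℤ] ℤ) (S : Submodule ℤ M) (m : ℕ)
    (G : Matrix (Fin m) (Fin m) ℤ) : Prop :=
  ∃ f : (Fin m → ℤ) →ₗ[ℤ] M, Function.Injective f ∧ LinearMap.range f = S ∧
    ∀ x y : Fin m → ℤ, D (f x) (f y) = x ⬝ᵥ G.mulVec y

/-- Two sublattices of `(M, D)` are isometric. -/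
def SubIsometric {M : Type*} [AddCommGroup M] [Module ℤ M]
    (D : M →ₗ[ℤ] M →ₗ[ℤ] ℤ) (S T : Submodule ℤ M) : Prop :=
  ∃ e : ↥S ≃ₗ[ℤ] ↥T, ∀ x y : ↥S, D ((e x) : M) ((e y) : M) = D (x : M) (y : M)

namespace RootLattice

/-- A symmetric, negative definite, even integral bilinear form. -/
structure IsEvenNegDef {M : Type*} [AddCommGroup M]
    (D : M →ₗ[ℤ] M →ₗ[ℤ] ℤ) : Prop where
  symm : ∀ x y : M, D x y = D y x
  neg : ∀ x : M, x ≠ 0 → D x x < 0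
  even : ∀ x : M, Even (D x x)

/-- The Weyl group: the group generated by the reflections in the roots. -/
def weyl {M : Type*} [AddCommGroup M]
    (D : M →ₗ[ℤ] M →ₗ[ℤ] ℤ) : Subgroup (M ≃ₗ[ℤ] M) :=
  Subgroup.closure {f : M ≃ₗ[ℤ] M | ∃ r : M, D r r = -2 ∧ ∀ x : M, f x = x + D x r • r}

/-- A linearly independent family of roots with pairwise products `0` or more. -/
structure IsSimpleFamily {M : Type*} [AddCommGroup M]
    (D : M →ₗ[ℤ] M →ₗ[ℤ] ℤ) {ι : Type*} (b : ι → M) : Prop where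
  root : ∀ i, D (b i) (b i) = -2
  nonneg : ∀ i j, i ≠ j → 0 ≤ D (b i) (b j)
  li : LinearIndependent ℤ b

/-- The Gram matrix of a family of vectors. -/
def gram {M : Type*} [AddCommGroup M]
    (D : M →ₗ[ℤ] M →ₗ[ℤ] ℤ) {ι : Type*} (b : ι → M) : Matrix ι ι ℤ :=
  Matrix.of fun i j => D (b i) (b j)

section
variable {M : Type*} [AddCommGroup M] {D : M →ₗ[ℤ] M →ₗ[ℤ] ℤ}

theorem IsEvenNegDef.nonpos (hD : IsEvenNegDef D) (x : M) : D x x ≤ 0 := by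
  by_cases h : x = 0
  · simp [h]
  · exact (hD.neg x h).le

theorem IsEvenNegDef.eq_zero (hD : IsEvenNegDef D) {x : M} (h : 0 ≤ D x x) : x = 0 := by
  by_contra hx
  exact absurd (hD.neg x hx) (not_lt.mpr h)

theorem IsEvenNegDef.le_neg_two (hD : IsEvenNegDef D) {x : M} (h : x ≠ 0) :
    D x x ≤ -2 := by
  have h1 := hD.neg x h
  obtain ⟨k, hk⟩ := hD.even x
  omega

theorem IsEvenNegDef.eq_zero_of_ne_zero_smul (hD : IsEvenNegDef D) {x : M} {c : ℤ} (hc : c ≠ 0)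
    (h : c • x = 0) : x = 0 := by
  apply hD.eq_zero
  have h1 : D (c • x) x = 0 := by rw [h]; simp
  simp only [map_smul, LinearMap.smul_apply, smul_eq_mul] at h1
  rcases mul_eq_zero.mp h1 with h2 | h2
  · exact absurd h2 hc
  · exact h2.ge

theorem IsEvenNegDef.cauchy_schwarz (hD : IsEvenNegDef D) (x y : M) :
    D x y ^ 2 ≤ D x x * D y y := by
  by_cases hx : x = 0
  · simp [hx]
  have hA := hD.neg x hx
  have h := hD.nonpos (D x x • y - D x y • x)
  simp only [map_sub, map_smul, LinearMap.sub_apply, LinearMap.smul_apply, smul_eq_mul,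
    hD.symm y x] at h
  nlinarith

/-- The reflection in a root. -/
def reflection (r : M) (hr : D r r = -2) : M ≃ₗ[ℤ] M :=
  LinearEquiv.ofInvolutive
    { toFun := fun x => x + D x r • r
      map_add' := fun x y => by
        rw [map_add, LinearMap.add_apply]; module
      map_smul' := fun c x => by
        rw [map_smul, LinearMap.smul_apply, smul_eq_mul]; simp only [RingHom.id_apply]; module }
    (fun x => by
      simp only [LinearMap.coe_mk, AddHom.coe_mk, map_add, map_smul, hr]
      module)

theorem reflection_apply (r : M) (hr : D r r = -2) (x : M) :
    reflection r hr x = x + D x r • r := rfl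

theorem reflection_mem_weyl (r : M) (hr : D r r = -2) :
    reflection r hr ∈ weyl D :=
  Subgroup.subset_closure ⟨r, hr, fun _ => rfl⟩

theorem weyl_isometry (hD : IsEvenNegDef D) {w : M ≃ₗ[ℤ] M} (hw : w ∈ weyl D) :
    ∀ x y, D (w x) (w y) = D x y := by
  unfold weyl at hw
  induction hw using Subgroup.closure_induction with
  | mem f hf =>
    obtain ⟨r, hr, hf⟩ := hf
    intro x y
    simp only [hf, map_add, map_smul, LinearMap.add_apply, LinearMap.smul_apply, smul_eq_mul, hr,
      hD.symm r y]
    ring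
  | one => intro x y; rfl
  | mul f g _ _ hf hg => intro x y; rw [LinearEquiv.mul_apply, LinearEquiv.mul_apply, hf, hg]
  | inv f _ hf =>
    intro x y
    rw [← hf, ← LinearEquiv.mul_apply, ← LinearEquiv.mul_apply, mul_inv_cancel]
    rfl

theorem weyl_congr_mod (N : ℤ) {w : M ≃ₗ[ℤ] M} (hw : w ∈ weyl D) :
    ∀ x, (∀ y, N ∣ D x y) → ∃ z, w x = x + N • z := by
  unfold weyl at hw
  induction hw using Subgroup.closure_induction with
  | mem f hf =>
    obtain ⟨r, hr, hf⟩ := hf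
    intro x hx
    obtain ⟨k, hk⟩ := hx r
    exact ⟨k • r, by rw [hf, hk, mul_smul]⟩
  | one => intro x _; exact ⟨0, by simp⟩
  | mul f g _ _ hf hg =>
    intro x hx
    obtain ⟨z, hz⟩ := hg x hx
    obtain ⟨z', hz'⟩ := hf x hx
    refine ⟨z' + f z, ?_⟩
    rw [LinearEquiv.mul_apply, hz, map_add, map_smul, hz']
    module
  | inv f _ hf =>
    intro x hx
    obtain ⟨z, hz⟩ := hf x hx
    refine ⟨-(f⁻¹ z), ?_⟩
    have h : f⁻¹ (f x) = x := by
      rw [← LinearEquiv.mul_apply, inv_mul_cancel]; rfl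
    have h2 : f⁻¹ (f x) = f⁻¹ x + N • f⁻¹ z := by rw [hz, map_add, map_smul]
    rw [h] at h2
    rw [smul_neg, ← sub_eq_add_neg]
    exact eq_sub_of_add_eq h2.symm

theorem dual_sum {ι : Type*} [Fintype ι] (b : ι → M) (v : ι → ℤ) (y : M) :
    D (∑ i, v i • b i) y = ∑ i, v i * D (b i) y := by
  simp [map_sum, LinearMap.sum_apply]

theorem sum_dual {ι : Type*} [Fintype ι] (b : ι → M) (v : ι → ℤ) (y : M) :
    D y (∑ i, v i • b i) = ∑ i, v i * D y (b i) := by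
  simp [map_sum]

theorem dual_eq_gram_mulVec (hD : IsEvenNegDef D) {ι : Type*} [Fintype ι] (b : ι → M) (v : ι → ℤ)
    (j : ι) : D (∑ i, v i • b i) (b j) = (gram D b *ᵥ v) j := by
  rw [dual_sum, Matrix.mulVec, dotProduct]
  exact Finset.sum_congr rfl fun i _ => by rw [gram, Matrix.of_apply, hD.symm, mul_comm]

theorem sum_self_eq_zero (hD : IsEvenNegDef D) {ι : Type*} [Fintype ι] (b : ι → M) (v : ι → ℤ)
    (h : gram D b *ᵥ v = 0) : ∑ i, v i • b i = 0 := by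
  apply hD.eq_zero
  have h0 : ∀ j, D (∑ i, v i • b i) (b j) = 0 := fun j => by
    rw [dual_eq_gram_mulVec hD, h, Pi.zero_apply]
  rw [sum_dual]
  simp only [h0, mul_zero, Finset.sum_const_zero, le_refl]

theorem gram_det_ne_zero (hD : IsEvenNegDef D) {ι : Type*} [Fintype ι] [DecidableEq ι]
    (b : ι → M) (hb : LinearIndependent ℤ b) : (gram D b).det ≠ 0 := by
  intro h
  obtain ⟨v, hv, h0⟩ := Matrix.exists_mulVec_eq_zero_iff.mpr h
  have := Fintype.linearIndependent_iff.mp hb v (sum_self_eq_zero hD b v h0)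
  exact hv (funext this)

theorem li_of_gram_det_ne_zero {ι : Type*} [Fintype ι] [DecidableEq ι] (hD : IsEvenNegDef D)
    (b : ι → M) (hb : (gram D b).det ≠ 0) : LinearIndependent ℤ b := by
  rw [Fintype.linearIndependent_iff]
  intro v hv
  have h : gram D b *ᵥ v = 0 := by
    ext j
    rw [← dual_eq_gram_mulVec hD, hv]
    simp
  exact congrFun (Matrix.eq_zero_of_mulVec_eq_zero hb h)

/-- A vector pairing to the same positive integer with every member of the family. -/
theorem exists_coweight (hD : IsEvenNegDef D) {ι : Type*} [Fintype ι]
    (b : ι → M) (hb : LinearIndependent ℤ b) :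
    ∃ (r : M) (N : ℤ), 0 < N ∧ ∀ i, D r (b i) = N := by
  classical
  set d := (gram D b).det with hd
  have hd0 : d ≠ 0 := gram_det_ne_zero hD b hb
  refine ⟨∑ i, (d • ((gram D b).adjugate *ᵥ fun _ => (1 : ℤ))) i • b i, d * d,
    mul_self_pos.mpr hd0, fun i => ?_⟩
  rw [dual_eq_gram_mulVec hD, Matrix.mulVec_smul, Matrix.mulVec_mulVec, Matrix.mul_adjugate,
    Matrix.smul_mulVec, Matrix.one_mulVec]
  simp [← hd]

/-- Every vector can be moved into the chamber of a simple family, by an element of the Weyl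
group acting trivially modulo the span of the family. -/
theorem exists_dominant (hD : IsEvenNegDef D) {ι : Type*} [Fintype ι] {b : ι → M}
    (hb : IsSimpleFamily D b) (x : M) :
    ∃ w ∈ weyl D, (∀ y, w y - y ∈ Submodule.span ℤ (Set.range b)) ∧ ∀ i, 0 ≤ D (w x) (b i) := by
  obtain ⟨r, N, hN, hr⟩ := exists_coweight hD b hb.li
  let P : ℤ → Prop := fun z => ∃ w ∈ weyl D,
    (∀ y, w y - y ∈ Submodule.span ℤ (Set.range b)) ∧ D r (w x) = z
  have hbdd : ∃ k : ℤ, ∀ z, P z → k ≤ z := by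
    refine ⟨-(D r r * D x x), ?_⟩
    rintro z ⟨w, hw, -, rfl⟩
    have h := hD.cauchy_schwarz r (w x)
    rw [weyl_isometry hD hw] at h
    nlinarith
  have hinh : ∃ z, P z := ⟨D r x, 1, one_mem _, fun y => by simp, rfl⟩
  obtain ⟨z, ⟨w, hw, hw1, hw2⟩, hmin⟩ := Int.exists_least_of_bdd hbdd hinh
  refine ⟨w, hw, hw1, fun i => ?_⟩
  by_contra hneg
  push Not at hneg
  have h := hmin (D r (reflection (b i) (hb.root i) (w x)))
    ⟨reflection (b i) (hb.root i) * w,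
      mul_mem (reflection_mem_weyl _ _) hw, fun y => ?_, rfl⟩
  · rw [reflection_apply, map_add, map_smul, hr, hw2, smul_eq_mul] at h
    nlinarith
  · rw [LinearEquiv.mul_apply, reflection_apply]
    have h3 : D (w y) (b i) • b i ∈ Submodule.span ℤ (Set.range b) :=
      Submodule.smul_mem _ _ (Submodule.subset_span ⟨i, rfl⟩)
    have h4 := add_mem (hw1 y) h3
    convert h4 using 1
    module

/-- A root in the span of a simple family is a nonnegative or a nonpositive combination. -/
theorem root_coeff_sign (hD : IsEvenNegDef D) {ι : Type*} [Fintype ι] {b : ι → M}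
    (hb : IsSimpleFamily D b) (v : ι → ℤ) (h : D (∑ i, v i • b i) (∑ i, v i • b i) = -2) :
    (∀ i, 0 ≤ v i) ∨ (∀ i, v i ≤ 0) := by
  set p := ∑ i, (v i)⁺ • b i with hp
  set q := ∑ i, (v i)⁻ • b i with hq
  have hpq : ∑ i, v i • b i = p - q := by
    rw [hp, hq, ← Finset.sum_sub_distrib]
    exact Finset.sum_congr rfl fun i _ => by rw [← sub_smul, posPart_sub_negPart]
  have hcross : 0 ≤ D p q := by
    rw [hp, dual_sum]
    refine Finset.sum_nonneg fun i _ => ?_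
    rw [hq, sum_dual, Finset.mul_sum]
    refine Finset.sum_nonneg fun j _ => ?_
    by_cases hij : i = j
    · subst hij
      rcases le_total 0 (v i) with h0 | h0
      · simp [negPart_eq_zero.mpr h0]
      · simp [posPart_eq_zero.mpr h0]
    · exact mul_nonneg (posPart_nonneg _) (mul_nonneg (negPart_nonneg _) (hb.nonneg i j hij))
  rw [hpq] at h
  simp only [map_sub, LinearMap.sub_apply, hD.symm q p] at h
  by_cases hp0 : p = 0
  · right
    intro i
    exact posPart_eq_zero.mp (Fintype.linearIndependent_iff.mp hb.li _ hp0 i)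
  by_cases hq0 : q = 0
  · left
    intro i
    exact negPart_eq_zero.mp (Fintype.linearIndependent_iff.mp hb.li _ hq0 i)
  have h1 := hD.le_neg_two hp0
  have h2 := hD.le_neg_two hq0
  omega

theorem mem_span_range {ι : Type*} [Fintype ι] {b : ι → M} {x : M}
    (h : x ∈ Submodule.span ℤ (Set.range b)) : ∃ v : ι → ℤ, ∑ i, v i • b i = x :=
  (Submodule.mem_span_range_iff_exists_fun ℤ).mp h

theorem mem_span_iff_of_sub_mem {S : Submodule ℤ M} {w : M ≃ₗ[ℤ] M} (hw : ∀ y, w y - y ∈ S)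
    (x : M) : w x ∈ S ↔ x ∈ S := by
  constructor
  · intro h
    have := sub_mem h (hw x)
    simpa using this
  · intro h
    have := add_mem (hw x) h
    simpa using this

/-- Two simple families with the same span are conjugate under the Weyl group. -/
theorem exists_weyl_range_eq (hD : IsEvenNegDef D) {ι κ : Type*} [Fintype ι] [Fintype κ]
    {b : ι → M} {c : κ → M} (hb : IsSimpleFamily D b) (hc : IsSimpleFamily D c)
    (hspan : Submodule.span ℤ (Set.range b) = Submodule.span ℤ (Set.range c)) :
    ∃ w ∈ weyl D, Set.range (fun i => w (b i)) = Set.range c := by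
  classical
  obtain ⟨r, N, hN, hr⟩ := exists_coweight hD b hb.li
  obtain ⟨w, hw, hw1, hw2⟩ := exists_dominant hD hc r
  refine ⟨w, hw, ?_⟩
  have hbc : ∀ i, ∃ v : κ → ℤ, ∑ j, v j • c j = w (b i) := fun i => by
    apply mem_span_range
    rw [mem_span_iff_of_sub_mem hw1, ← hspan]
    exact Submodule.subset_span ⟨i, rfl⟩
  choose n hn using hbc
  have hn0 : ∀ i l, 0 ≤ n i l := by
    intro i
    rcases root_coeff_sign hD hc (n i)
      (by rw [hn, weyl_isometry hD hw, hb.root]) with h | h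
    · exact h
    · exfalso
      have h1 : D (w r) (w (b i)) = N := by rw [weyl_isometry hD hw, hr]
      rw [← hn, sum_dual] at h1
      have : ∑ j, n i j * D (w r) (c j) ≤ 0 :=
        Finset.sum_nonpos fun j _ => mul_nonpos_of_nonpos_of_nonneg (h j) (hw2 j)
      omega
  have key : ∀ j, ∃ i, w (b i) = c j := by
    intro j
    have hj : c j ∈ Submodule.span ℤ (Set.range c) := Submodule.subset_span ⟨j, rfl⟩
    have hj2 : w.symm (c j) ∈ Submodule.span ℤ (Set.range b) := by
      rw [hspan, ← mem_span_iff_of_sub_mem hw1, LinearEquiv.apply_symm_apply]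
      exact hj
    obtain ⟨k, hk⟩ := mem_span_range hj2
    have hk' : ∑ i, k i • w (b i) = c j := by
      rw [← LinearEquiv.apply_symm_apply w (c j), ← hk, map_sum]
      simp only [map_smul]
    have hcoef : ∀ l, ∑ i, k i * n i l = if l = j then 1 else 0 := by
      have h1 : ∑ l, (∑ i, k i * n i l - if l = j then 1 else 0) • c l = 0 := by
        simp only [sub_smul, Finset.sum_sub_distrib, ite_smul, one_smul, zero_smul,
          Finset.sum_ite_eq', Finset.mem_univ, if_true, Finset.sum_smul]
        rw [Finset.sum_comm, sub_eq_zero]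
        refine Eq.trans (Finset.sum_congr rfl fun i _ => ?_) hk'
        rw [← hn i, Finset.smul_sum]
        exact Finset.sum_congr rfl fun l _ => by rw [mul_smul]
      intro l
      exact sub_eq_zero.mp (Fintype.linearIndependent_iff.mp hc.li _ h1 l)
    have hk0 : ∀ i, 0 ≤ k i := by
      rcases root_coeff_sign hD hb k
        (by rw [hk, ← weyl_isometry hD hw, LinearEquiv.apply_symm_apply, hc.root]) with h | h
      · exact h
      · exfalso
        have h1 := hcoef j
        rw [if_pos rfl] at h1
        have : ∑ i, k i * n i j ≤ 0 :=
          Finset.sum_nonpos fun i _ => mul_nonpos_of_nonpos_of_nonneg (h i) (hn0 i j)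
        omega
    obtain ⟨i, hi⟩ : ∃ i, k i ≠ 0 := by
      by_contra hall
      push Not at hall
      have h1 := hcoef j
      simp [hall] at h1
    have hi1 : 1 ≤ k i := by have := hk0 i; omega
    have hle : ∀ l, n i l ≤ if l = j then 1 else 0 := fun l => by
      rw [← hcoef l]
      have h1 : k i * n i l ≤ ∑ i, k i * n i l :=
        Finset.single_le_sum (f := fun i => k i * n i l)
          (fun i _ => mul_nonneg (hk0 i) (hn0 i l)) (Finset.mem_univ i)
      nlinarith [hn0 i l]
    refine ⟨i, ?_⟩
    have hnil : ∀ l, l ≠ j → n i l = 0 := fun l hl => by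
      have h1 := hle l
      rw [if_neg hl] at h1
      have := hn0 i l
      omega
    have hsum : n i j • c j = w (b i) := by
      rw [← hn i, Finset.sum_eq_single j]
      · intro l _ hl
        rw [hnil l hl, zero_smul]
      · simp
    have hnij : n i j = 1 := by
      have h1 := hle j
      rw [if_pos rfl] at h1
      have h2 := hn0 i j
      have h3 : n i j ≠ 0 := by
        intro h0
        rw [h0, zero_smul] at hsum
        have h4 := weyl_isometry hD hw (b i) (b i)
        rw [← hsum, hb.root] at h4
        simp at h4
      omega
    rw [← hsum, hnij, one_smul]
  choose s hs using key
  have hs_inj : Function.Injective s := fun j j' h => hc.li.injective (by rw [← hs, ← hs, h])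
  have hcard : Fintype.card κ = Fintype.card ι := by
    rw [← finrank_span_eq_card hb.li, ← finrank_span_eq_card hc.li, hspan]
  have hs_bij : Function.Bijective s :=
    (Fintype.bijective_iff_injective_and_card s).mpr ⟨hs_inj, hcard⟩
  apply Set.Subset.antisymm
  · rintro _ ⟨i, rfl⟩
    obtain ⟨j, rfl⟩ := hs_bij.2 i
    exact ⟨j, (hs j).symm⟩
  · rintro _ ⟨j, rfl⟩
    exact ⟨s j, hs j⟩

end

/-- Neighbourhoods of a connected finite simple graph on `V` together with positive integer marks
such that twice the mark of a vertex is the sum of the marks of its neighbours. -/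
structure AffineMarks {V : Type*} [DecidableEq V] (N : V → Finset V) (m : V → ℤ) : Prop where
  symm : ∀ v w, w ∈ N v → v ∈ N w
  irrefl : ∀ v, v ∉ N v
  pos : ∀ v, 0 < m v
  sum : ∀ v, ∑ w ∈ N v, m w = 2 * m v
  conn : ∀ P : V → Prop, (∃ v, P v) → (∀ v w, P v → w ∈ N v → P w) → ∀ v, P v

section
variable {V : Type*} [DecidableEq V] {N : V → Finset V} {m : V → ℤ}

theorem AffineMarks.le_two_mul (h : AffineMarks N m) {v w : V} (hw : w ∈ N v) :
    m w ≤ 2 * m v := by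
  rw [← h.sum v]
  exact Finset.single_le_sum (fun x _ => (h.pos x).le) hw

theorem AffineMarks.sum_le (h : AffineMarks N m) {v : V} {S : Finset V} (hS : S ⊆ N v) :
    ∑ w ∈ S, m w ≤ 2 * m v := by
  rw [← h.sum v]
  exact Finset.sum_le_sum_of_subset_of_nonneg hS fun x _ _ => (h.pos x).le

theorem AffineMarks.eq_of_sum_eq (h : AffineMarks N m) {v : V} {S : Finset V} (hS : S ⊆ N v)
    (hsum : ∑ w ∈ S, m w = 2 * m v) : N v = S := by
  by_contra hne
  obtain ⟨x, hx, hxS⟩ : ∃ x ∈ N v, x ∉ S := by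
    by_contra hall
    push Not at hall
    exact hne (Finset.Subset.antisymm hall hS)
  have h1 := h.sum_le (Finset.insert_subset hx hS)
  rw [Finset.sum_insert hxS] at h1
  have := h.pos x
  omega

theorem AffineMarks.step (h : AffineMarks N m) {u v : V} {d : ℤ} (hv : v ∈ N u) (hd : 0 < d)
    (hm : m v = m u - d) :
    (m v = d ∧ N v = {u}) ∨ ∃ w, w ≠ u ∧ N v = {u, w} ∧ m w = m v - d := by
  have hu := h.symm _ _ hv
  by_cases h1 : ∃ w ∈ N v, w ≠ u
  · right
    obtain ⟨w, hw, hwu⟩ := h1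
    have h2 : N v = {u, w} := by
      by_contra hne
      obtain ⟨x, hx, hxu, hxw⟩ : ∃ x ∈ N v, x ≠ u ∧ x ≠ w := by
        by_contra hall
        push Not at hall
        apply hne
        ext y
        simp only [Finset.mem_insert, Finset.mem_singleton]
        refine ⟨fun hy => ?_, ?_⟩
        · by_cases hyu : y = u
          · exact Or.inl hyu
          · exact Or.inr (hall y hy hyu)
        · rintro (rfl | rfl) <;> assumption
      have hS : ({u, w, x} : Finset V) ⊆ N v := by
        intro y
        simp only [Finset.mem_insert, Finset.mem_singleton]
        rintro (rfl | rfl | rfl) <;> assumption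
      have h3 := h.sum_le hS
      rw [Finset.sum_insert (by simp [Ne.symm hwu, Ne.symm hxu]),
        Finset.sum_insert (by simp [Ne.symm hxw]), Finset.sum_singleton] at h3
      have h4 := h.le_two_mul (h.symm _ _ hw)
      have h5 := h.le_two_mul (h.symm _ _ hx)
      omega
    refine ⟨w, hwu, h2, ?_⟩
    have h3 := h.sum v
    rw [h2, Finset.sum_pair (Ne.symm hwu)] at h3
    omega
  · left
    push Not at h1
    have h2 : N v = {u} := by
      ext y
      rw [Finset.mem_singleton]
      exact ⟨fun hy => h1 y hy, fun hy => hy ▸ hu⟩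
    have h3 := h.sum v
    rw [h2, Finset.sum_singleton] at h3
    exact ⟨by omega, h2⟩

theorem AffineMarks.leaf (h : AffineMarks N m) {u v : V} {d : ℤ} (hv : v ∈ N u) (hd : 0 < d)
    (hm : m v = m u - d) (hmd : m v = d) : N v = {u} := by
  rcases h.step hv hd hm with h1 | ⟨w, -, -, h1⟩
  · exact h1.2
  · have := h.pos w
    omega

theorem AffineMarks.next (h : AffineMarks N m) {u v : V} {d : ℤ} (hv : v ∈ N u) (hd : 0 < d)
    (hm : m v = m u - d) (hmd : m v ≠ d) : ∃ w, N v = {u, w} ∧ w ∈ N v ∧ m w = m v - d := by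
  rcases h.step hv hd hm with h1 | ⟨w, -, h1, h2⟩
  · exact absurd h1.1 hmd
  · exact ⟨w, h1, by simp [h1], h2⟩

theorem AffineMarks.exists_mul (h : AffineMarks N m) {d : ℤ} (hd : 0 < d) :
    ∀ (k : ℕ) (u v : V), m v ≤ k → v ∈ N u → m v = m u - d → ∃ l : ℤ, 2 ≤ l ∧ m u = l * d := by
  intro k
  induction k with
  | zero =>
    intro u v hk
    have := h.pos v
    norm_num at hk
    omega
  | succ k ih =>
    intro u v hk hv hm
    rcases h.step hv hd hm with h1 | ⟨w, -, h1, h2⟩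
    · exact ⟨2, le_refl _, by omega⟩
    · obtain ⟨l, hl, hl2⟩ := ih v w (by push_cast at hk; omega) (by simp [h1]) h2
      exact ⟨l + 1, by omega, by linarith⟩

/-- Adjacency in the affine diagram of type `E₇`: a chain `0, …, 6` and a node `7` attached
to `3`. -/
def affE7Adj (i j : Fin 8) : Bool :=
  (i.val + 1 == j.val && j.val ≤ 6) || (j.val + 1 == i.val && i.val ≤ 6) ||
    (i.val == 7 && j.val == 3) || (j.val == 7 && i.val == 3)

/-- Adjacency in the affine diagram of type `E₈`: a chain `0, …, 7` and a node `8` attached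
to `5`. -/
def affE8Adj (i j : Fin 9) : Bool :=
  (i.val + 1 == j.val && j.val ≤ 7) || (j.val + 1 == i.val && i.val ≤ 7) ||
    (i.val == 8 && j.val == 5) || (j.val == 8 && i.val == 5)

/-- `f` identifies the graph with neighbourhoods `N` with the graph of `adj`. -/
structure IsLabelling {n : ℕ} (N : V → Finset V) (adj : Fin n → Fin n → Bool) (f : Fin n → V) :
    Prop where
  inj : Function.Injective f
  surj : Function.Surjective f
  mem_iff : ∀ i j, f j ∈ N (f i) ↔ adj i j = true

theorem AffineMarks.isLabelling (h : AffineMarks N m) {n : ℕ} (hn : 0 < n)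
    {adj : Fin n → Fin n → Bool} {f : Fin n → V} (hf : Function.Injective f)
    (hN : ∀ i, N (f i) = (Finset.univ.filter fun j => adj i j = true).image f) :
    IsLabelling N adj f := by
  refine ⟨hf, fun v => ?_, fun i j => ?_⟩
  · refine h.conn (fun v => ∃ i, f i = v) ⟨f ⟨0, hn⟩, _, rfl⟩ ?_ v
    rintro _ w ⟨i, rfl⟩ hw
    rw [hN] at hw
    obtain ⟨j, -, hj⟩ := Finset.mem_image.mp hw
    exact ⟨j, hj⟩
  · rw [hN, Finset.mem_image]
    constructor
    · rintro ⟨k, hk, hkj⟩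
      rw [← hf hkj]
      exact (Finset.mem_filter.mp hk).2
    · exact fun hij => ⟨j, Finset.mem_filter.mpr ⟨Finset.mem_univ _, hij⟩, rfl⟩

theorem ne_of_mark {d : ℤ} (hd : 0 < d) {u v : V} {k l : ℤ} (hu : m u = k * d) (hv : m v = l * d)
    (hkl : k ≠ l) : u ≠ v := by
  rintro rfl
  exact hkl (mul_right_cancel₀ hd.ne' (hu.symm.trans hv))

theorem AffineMarks.leaf_mul (h : AffineMarks N m) {u v : V} {d : ℤ} (hd : 0 < d) (hv : v ∈ N u)
    (hu : m u = 2 * d) (hm : m v = 1 * d) : N v = {u} :=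
  h.leaf hv hd (by linarith) (by linarith)

theorem AffineMarks.next_mul (h : AffineMarks N m) {u v : V} {d : ℤ} (hd : 0 < d) (hv : v ∈ N u)
    (k : ℤ) (hu : m u = (k + 2) * d) (hm : m v = (k + 1) * d) (hk : k ≠ 0) :
    ∃ w, N v = {u, w} ∧ w ∈ N v ∧ m w = k * d := by
  have hne : m v ≠ d := fun h' => hk <| by
    have : k * d = 0 := by linarith
    exact (mul_eq_zero.mp this).resolve_right hd.ne'
  obtain ⟨w, h1, h2, h3⟩ := h.next (d := d) hv hd (by linarith) hne
  exact ⟨w, h1, h2, by linarith⟩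

theorem leaf_ne {y c v u w : V} (hy : N y = {c}) (hu : u ∈ N v) (hw : w ∈ N v) (huw : u ≠ w) :
    v ≠ y := by
  rintro rfl
  rw [hy, Finset.mem_singleton] at hu hw
  exact huw (hu.trans hw.symm)

theorem AffineMarks.false_of_E6 (h : AffineMarks N m) {d : ℤ} (hd : 0 < d) {y e z a₁ b₁ c₁ : V}
    (hy : N y = {e}) (hdvd : ¬ ∀ v, m y ∣ m v) (hz : N z = {a₁, b₁, c₁}) (hab : a₁ ≠ b₁)
    (hmz : m z = 3 * d) (ha : m a₁ = 2 * d) (hb : m b₁ = 2 * d) (hc : m c₁ = 2 * d) : False := by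
  have haz : a₁ ∈ N z := by simp [hz]
  have hbz : b₁ ∈ N z := by simp [hz]
  have hcz : c₁ ∈ N z := by simp [hz]
  obtain ⟨a₂, hNa₁, ha₂, hma₂⟩ := h.next_mul hd haz 1 hmz ha (by norm_num)
  obtain ⟨b₂, hNb₁, hb₂, hmb₂⟩ := h.next_mul hd hbz 1 hmz hb (by norm_num)
  obtain ⟨c₂, hNc₁, hc₂, hmc₂⟩ := h.next_mul hd hcz 1 hmz hc (by norm_num)
  have hNa₂ := h.leaf_mul hd ha₂ ha hma₂
  have hNb₂ := h.leaf_mul hd hb₂ hb hmb₂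
  have hNc₂ := h.leaf_mul hd hc₂ hc hmc₂
  have hall : ∀ v, v = z ∨ v = a₁ ∨ v = b₁ ∨ v = c₁ ∨ v = a₂ ∨ v = b₂ ∨ v = c₂ := by
    apply h.conn
    · exact ⟨z, Or.inl rfl⟩
    · rintro v w (rfl | rfl | rfl | rfl | rfl | rfl | rfl) hw
      · rw [hz, Finset.mem_insert, Finset.mem_insert, Finset.mem_singleton] at hw; tauto
      · rw [hNa₁, Finset.mem_insert, Finset.mem_singleton] at hw; tauto
      · rw [hNb₁, Finset.mem_insert, Finset.mem_singleton] at hw; tauto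
      · rw [hNc₁, Finset.mem_insert, Finset.mem_singleton] at hw; tauto
      · rw [hNa₂, Finset.mem_singleton] at hw; tauto
      · rw [hNb₂, Finset.mem_singleton] at hw; tauto
      · rw [hNc₂, Finset.mem_singleton] at hw; tauto
  have hmy : m y = d := by
    rcases hall y with hv | hv | hv | hv | hv | hv | hv
    · exact absurd hv.symm (leaf_ne hy haz hbz hab)
    · exact absurd hv.symm (leaf_ne hy (h.symm _ _ haz) ha₂ (ne_of_mark hd hmz hma₂ (by norm_num)))
    · exact absurd hv.symm (leaf_ne hy (h.symm _ _ hbz) hb₂ (ne_of_mark hd hmz hmb₂ (by norm_num)))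
    · exact absurd hv.symm (leaf_ne hy (h.symm _ _ hcz) hc₂ (ne_of_mark hd hmz hmc₂ (by norm_num)))
    all_goals rw [hv]; linarith
  apply hdvd
  intro v
  rw [hmy]
  rcases hall v with rfl | rfl | rfl | rfl | rfl | rfl | rfl
  · exact ⟨3, by linarith⟩
  · exact ⟨2, by linarith⟩
  · exact ⟨2, by linarith⟩
  · exact ⟨2, by linarith⟩
  · exact ⟨1, by linarith⟩
  · exact ⟨1, by linarith⟩
  · exact ⟨1, by linarith⟩

/-- A labelling carrying the marks of a finite list of integers to marks of the graph. -/
theorem IsLabelling.dvd_of_marks {n : ℕ} {adj : Fin n → Fin n → Bool} {f : Fin n → V}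
    (hf : IsLabelling N adj f) {d : ℤ} {μ : Fin n → ℤ} (hμ : ∀ i, m (f i) = μ i * d) (v : V) :
    d ∣ m v := by
  obtain ⟨i, rfl⟩ := hf.surj v
  exact ⟨μ i, by rw [hμ, mul_comm]⟩

theorem AffineMarks.labelling_E7 (h : AffineMarks N m) {d : ℤ} (hd : 0 < d) {y e z a₁ b₁ c₁ : V}
    (hy : N y = {e}) (hdvd : ¬ ∀ v, m y ∣ m v) (hz : N z = {a₁, b₁, c₁}) (hbc : b₁ ≠ c₁)
    (hmz : m z = 4 * d) (ha : m a₁ = 2 * d) (hb : m b₁ = 3 * d) (hc : m c₁ = 3 * d) :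
    ∃ f : Fin 8 → V, IsLabelling N affE7Adj f ∧ f 7 = y := by
  have haz : a₁ ∈ N z := by simp [hz]
  have hbz : b₁ ∈ N z := by simp [hz]
  have hcz : c₁ ∈ N z := by simp [hz]
  have hNa₁ := h.leaf (d := 2 * d) haz (by linarith) (by linarith) (by linarith)
  obtain ⟨b₂, hNb₁, hb₂, hmb₂⟩ := h.next_mul hd hbz 2 hmz hb (by norm_num)
  obtain ⟨c₂, hNc₁, hc₂, hmc₂⟩ := h.next_mul hd hcz 2 hmz hc (by norm_num)
  obtain ⟨b₃, hNb₂, hb₃, hmb₃⟩ := h.next_mul hd hb₂ 1 hb hmb₂ (by norm_num)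
  obtain ⟨c₃, hNc₂, hc₃, hmc₃⟩ := h.next_mul hd hc₂ 1 hc hmc₂ (by norm_num)
  have hNb₃ := h.leaf_mul hd hb₃ hmb₂ hmb₃
  have hNc₃ := h.leaf_mul hd hc₃ hmc₂ hmc₃
  have e1 : a₁ ≠ b₂ := fun e => by
    have : b₁ ∈ N a₁ := by rw [e, hNb₂]; simp
    rw [hNa₁, Finset.mem_singleton] at this
    exact ne_of_mark hd hb hmz (by norm_num) this
  have e2 : a₁ ≠ c₂ := fun e => by
    have : c₁ ∈ N a₁ := by rw [e, hNc₂]; simp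
    rw [hNa₁, Finset.mem_singleton] at this
    exact ne_of_mark hd hc hmz (by norm_num) this
  have e3 : b₂ ≠ c₂ := fun e => by
    have : b₁ ∈ N c₂ := by rw [← e, hNb₂]; simp
    rw [hNc₂, Finset.mem_insert, Finset.mem_singleton] at this
    rcases this with this | this
    · exact hbc this
    · exact ne_of_mark hd hb hmc₃ (by norm_num) this
  have e4 : b₃ ≠ c₃ := fun e => by
    have : b₂ ∈ N c₃ := by rw [← e, hNb₃]; simp
    rw [hNc₃, Finset.mem_singleton] at this
    exact e3 this
  obtain ⟨f, hf⟩ : ∃ f, f = ![b₃, b₂, b₁, z, c₁, c₂, c₃, a₁] := ⟨_, rfl⟩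
  have hμ : ∀ i, m (f i) = ![1, 2, 3, 4, 3, 2, 1, 2] i * d := by
    intro i
    subst hf
    fin_cases i
    exacts [hmb₃, hmb₂, hb, hmz, hc, hmc₂, hmc₃, ha]
  have hne : ∀ i j, f i = f j →
      (![1, 2, 3, 4, 3, 2, 1, 2] : Fin 8 → ℤ) i = ![1, 2, 3, 4, 3, 2, 1, 2] j := by
    intro i j hij
    by_contra hcon
    exact ne_of_mark hd (hμ i) (hμ j) hcon hij
  have hinj : Function.Injective f := by
    have hlt : ∀ i j, i < j → f i ≠ f j := by
      intro i j hij hfij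
      have h1 := hne i j hfij
      have h2 : (i = 0 ∧ j = 6) ∨ (i = 1 ∧ j = 5) ∨ (i = 2 ∧ j = 4) ∨ (i = 1 ∧ j = 7) ∨
          (i = 5 ∧ j = 7) := by
        clear hfij
        revert i j
        decide
      subst hf
      rcases h2 with ⟨rfl, rfl⟩ | ⟨rfl, rfl⟩ | ⟨rfl, rfl⟩ | ⟨rfl, rfl⟩ | ⟨rfl, rfl⟩
      · exact e4 hfij
      · exact e3 hfij
      · exact hbc hfij
      · exact e1 hfij.symm
      · exact e2 hfij.symm
    intro i j hij
    rcases lt_trichotomy i j with h1 | h1 | h1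
    · exact absurd hij (hlt _ _ h1)
    · exact h1
    · exact absurd hij.symm (hlt _ _ h1)
  have hlab : IsLabelling N affE7Adj f := by
    refine h.isLabelling (by norm_num) hinj fun i => ?_
    have hfin : ∀ S : Finset (Fin 8), Finset.univ.filter (fun j => affE7Adj i j = true) = S →
      (Finset.univ.filter fun j => affE7Adj i j = true).image f = S.image f :=
      fun S hS => by rw [hS]
    subst hf
    fin_cases i
    · rw [hfin {1} (by decide), Finset.image_singleton]; exact hNb₃
    · rw [hfin {2, 0} (by decide), Finset.image_insert, Finset.image_singleton]; exact hNb₂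
    · rw [hfin {3, 1} (by decide), Finset.image_insert, Finset.image_singleton]; exact hNb₁
    · rw [hfin {7, 2, 4} (by decide), Finset.image_insert, Finset.image_insert,
        Finset.image_singleton]; exact hz
    · rw [hfin {3, 5} (by decide), Finset.image_insert, Finset.image_singleton]; exact hNc₁
    · rw [hfin {4, 6} (by decide), Finset.image_insert, Finset.image_singleton]; exact hNc₂
    · rw [hfin {5} (by decide), Finset.image_singleton]; exact hNc₃
    · rw [hfin {3} (by decide), Finset.image_singleton]; exact hNa₁
  refine ⟨f, hlab, ?_⟩
  have hmy : m y ≠ d := fun hmy => hdvd fun v => by rw [hmy]; exact hlab.dvd_of_marks hμ v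
  obtain ⟨i, hi⟩ := hlab.surj y
  subst hf
  fin_cases i
  · exact absurd (by rw [← hi]; exact hmb₃.trans (one_mul d)) hmy
  · exact absurd hi (leaf_ne hy (h.symm _ _ hb₂) hb₃ (ne_of_mark hd hb hmb₃ (by norm_num)))
  · exact absurd hi (leaf_ne hy (h.symm _ _ hbz) hb₂ (ne_of_mark hd hmz hmb₂ (by norm_num)))
  · exact absurd hi (leaf_ne hy hbz hcz hbc)
  · exact absurd hi (leaf_ne hy (h.symm _ _ hcz) hc₂ (ne_of_mark hd hmz hmc₂ (by norm_num)))
  · exact absurd hi (leaf_ne hy (h.symm _ _ hc₂) hc₃ (ne_of_mark hd hc hmc₃ (by norm_num)))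
  · exact absurd (by rw [← hi]; exact hmc₃.trans (one_mul d)) hmy
  · exact hi

theorem AffineMarks.labelling_E8 (h : AffineMarks N m) {d : ℤ} (hd : 0 < d) {y e z a₁ b₁ c₁ : V}
    (hy : N y = {e}) (hdvd : ¬ ∀ v, m y ∣ m v) (hz : N z = {a₁, b₁, c₁})
    (hmz : m z = 6 * d) (ha : m a₁ = 3 * d) (hb : m b₁ = 4 * d) (hc : m c₁ = 5 * d) :
    ∃ f : Fin 9 → V, IsLabelling N affE8Adj f ∧ (f 7 = y ∨ f 8 = y) := by
  have haz : a₁ ∈ N z := by simp [hz]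
  have hbz : b₁ ∈ N z := by simp [hz]
  have hcz : c₁ ∈ N z := by simp [hz]
  have hNa₁ := h.leaf (d := 3 * d) haz (by linarith) (by linarith) (by linarith)
  obtain ⟨b₂, hNb₁, hb₂, hmb₂⟩ := h.next (d := 2 * d) hbz (by linarith) (by linarith) (by linarith)
  replace hmb₂ : m b₂ = 2 * d := by linarith
  have hNb₂ := h.leaf (d := 2 * d) hb₂ (by linarith) (by linarith) (by linarith)
  obtain ⟨c₂, hNc₁, hc₂, hmc₂⟩ := h.next_mul hd hcz 4 hmz hc (by norm_num)
  obtain ⟨c₃, hNc₂, hc₃, hmc₃⟩ := h.next_mul hd hc₂ 3 hc hmc₂ (by norm_num)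
  obtain ⟨c₄, hNc₃, hc₄, hmc₄⟩ := h.next_mul hd hc₃ 2 hmc₂ hmc₃ (by norm_num)
  obtain ⟨c₅, hNc₄, hc₅, hmc₅⟩ := h.next_mul hd hc₄ 1 hmc₃ hmc₄ (by norm_num)
  have hNc₅ := h.leaf_mul hd hc₅ hmc₄ hmc₅
  have e1 : a₁ ≠ c₃ := fun e => by
    have : c₂ ∈ N a₁ := by rw [e, hNc₃]; simp
    rw [hNa₁, Finset.mem_singleton] at this
    exact ne_of_mark hd hmc₂ hmz (by norm_num) this
  have e2 : b₁ ≠ c₂ := fun e => by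
    have : c₁ ∈ N b₁ := by rw [e, hNc₂]; simp
    rw [hNb₁, Finset.mem_insert, Finset.mem_singleton] at this
    rcases this with this | this
    · exact ne_of_mark hd hc hmz (by norm_num) this
    · exact ne_of_mark hd hc hmb₂ (by norm_num) this
  have e3 : b₂ ≠ c₄ := fun e => by
    have : c₃ ∈ N b₂ := by rw [e, hNc₄]; simp
    rw [hNb₂, Finset.mem_singleton] at this
    exact ne_of_mark hd hmc₃ hb (by norm_num) this
  obtain ⟨f, hf⟩ : ∃ f, f = ![c₅, c₄, c₃, c₂, c₁, z, b₁, b₂, a₁] := ⟨_, rfl⟩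
  have hμ : ∀ i, m (f i) = ![1, 2, 3, 4, 5, 6, 4, 2, 3] i * d := by
    intro i
    subst hf
    fin_cases i
    exacts [hmc₅, hmc₄, hmc₃, hmc₂, hc, hmz, hb, hmb₂, ha]
  have hinj : Function.Injective f := by
    have hlt : ∀ i j, i < j → f i ≠ f j := by
      intro i j hij hfij
      have h1 : (![1, 2, 3, 4, 5, 6, 4, 2, 3] : Fin 9 → ℤ) i = ![1, 2, 3, 4, 5, 6, 4, 2, 3] j := by
        by_contra hcon
        exact ne_of_mark hd (hμ i) (hμ j) hcon hfij
      have h2 : (i = 1 ∧ j = 7) ∨ (i = 2 ∧ j = 8) ∨ (i = 3 ∧ j = 6) := by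
        clear hfij
        revert i j
        decide
      subst hf
      rcases h2 with ⟨rfl, rfl⟩ | ⟨rfl, rfl⟩ | ⟨rfl, rfl⟩
      · exact e3 hfij.symm
      · exact e1 hfij.symm
      · exact e2 hfij.symm
    intro i j hij
    rcases lt_trichotomy i j with h1 | h1 | h1
    · exact absurd hij (hlt _ _ h1)
    · exact h1
    · exact absurd hij.symm (hlt _ _ h1)
  have hlab : IsLabelling N affE8Adj f := by
    refine h.isLabelling (by norm_num) hinj fun i => ?_
    have hfin : ∀ S : Finset (Fin 9), Finset.univ.filter (fun j => affE8Adj i j = true) = S →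
      (Finset.univ.filter fun j => affE8Adj i j = true).image f = S.image f :=
      fun S hS => by rw [hS]
    subst hf
    fin_cases i
    · rw [hfin {1} (by decide), Finset.image_singleton]; exact hNc₅
    · rw [hfin {2, 0} (by decide), Finset.image_insert, Finset.image_singleton]; exact hNc₄
    · rw [hfin {3, 1} (by decide), Finset.image_insert, Finset.image_singleton]; exact hNc₃
    · rw [hfin {4, 2} (by decide), Finset.image_insert, Finset.image_singleton]; exact hNc₂
    · rw [hfin {5, 3} (by decide), Finset.image_insert, Finset.image_singleton]; exact hNc₁
    · rw [hfin {8, 6, 4} (by decide), Finset.image_insert, Finset.image_insert,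
        Finset.image_singleton]; exact hz
    · rw [hfin {5, 7} (by decide), Finset.image_insert, Finset.image_singleton]; exact hNb₁
    · rw [hfin {6} (by decide), Finset.image_singleton]; exact hNb₂
    · rw [hfin {5} (by decide), Finset.image_singleton]; exact hNa₁
  refine ⟨f, hlab, ?_⟩
  have hmy : m y ≠ d := fun hmy => hdvd fun v => by rw [hmy]; exact hlab.dvd_of_marks hμ v
  obtain ⟨i, hi⟩ := hlab.surj y
  subst hf
  fin_cases i
  · exact absurd (by rw [← hi]; exact hmc₅.trans (one_mul d)) hmy
  · exact absurd hi (leaf_ne hy (h.symm _ _ hc₄) hc₅ (ne_of_mark hd hmc₃ hmc₅ (by norm_num)))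
  · exact absurd hi (leaf_ne hy (h.symm _ _ hc₃) hc₄ (ne_of_mark hd hmc₂ hmc₄ (by norm_num)))
  · exact absurd hi (leaf_ne hy (h.symm _ _ hc₂) hc₃ (ne_of_mark hd hc hmc₃ (by norm_num)))
  · exact absurd hi (leaf_ne hy (h.symm _ _ hcz) hc₂ (ne_of_mark hd hmz hmc₂ (by norm_num)))
  · exact absurd hi (leaf_ne hy haz hbz (ne_of_mark hd ha hb (by norm_num)))
  · exact absurd hi (leaf_ne hy (h.symm _ _ hbz) hb₂ (ne_of_mark hd hmz hmb₂ (by norm_num)))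
  · exact Or.inl hi
  · exact Or.inr hi

theorem AffineMarks.classify_sorted (h : AffineMarks N m) {y e z a₁ b₁ c₁ : V} (hy : N y = {e})
    (hdvd : ¬ ∀ v, m y ∣ m v) (hz : N z = {a₁, b₁, c₁}) (hab : a₁ ≠ b₁) (hac : a₁ ≠ c₁)
    (hbc : b₁ ≠ c₁) (h1 : m a₁ ≤ m b₁) (h2 : m b₁ ≤ m c₁) (hc : m c₁ < m z) :
    (∃ f : Fin 8 → V, IsLabelling N affE7Adj f ∧ f 7 = y) ∨
    (∃ f : Fin 9 → V, IsLabelling N affE8Adj f ∧ (f 7 = y ∨ f 8 = y)) := by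
  have hsum := h.sum z
  rw [hz, Finset.sum_insert (by simp [hab, hac]), Finset.sum_pair hbc] at hsum
  have harm : ∀ v ∈ N z, m v < m z → ∃ l : ℤ, 2 ≤ l ∧ m z = l * (m z - m v) := fun v hv hlt =>
    h.exists_mul (d := m z - m v) (by omega) (m v).toNat z v (Int.self_le_toNat _) hv (by omega)
  obtain ⟨la, hla, hla'⟩ := harm a₁ (by simp [hz]) (by omega)
  obtain ⟨lb, hlb, hlb'⟩ := harm b₁ (by simp [hz]) (by omega)
  obtain ⟨lc, hlc, hlc'⟩ := harm c₁ (by simp [hz]) (by omega)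
  obtain ⟨da, hda⟩ : ∃ d, d = m z - m a₁ := ⟨_, rfl⟩
  obtain ⟨db, hdb⟩ : ∃ d, d = m z - m b₁ := ⟨_, rfl⟩
  obtain ⟨dc, hdc⟩ : ∃ d, d = m z - m c₁ := ⟨_, rfl⟩
  rw [← hda] at hla'
  rw [← hdb] at hlb'
  rw [← hdc] at hlc'
  have hdc0 : 0 < dc := by omega
  have hlaz : la ≤ 3 := by nlinarith
  have hl : la = 3 ∨ la = 2 := by omega
  rcases hl with rfl | rfl
  · exfalso
    have e1 : da = db ∧ db = dc := by omega
    exact h.false_of_E6 hdc0 hy hdvd hz hab (by omega) (by omega) (by omega) (by omega)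
  · have hlbz : lb ≤ 4 := by nlinarith
    have hl : lb = 4 ∨ lb = 3 ∨ lb = 2 := by omega
    rcases hl with rfl | rfl | rfl
    · left
      exact h.labelling_E7 hdc0 hy hdvd hz hbc (by omega) (by omega) (by omega) (by omega)
    · right
      exact h.labelling_E8 hdc0 hy hdvd hz (by omega) (by omega) (by omega) (by omega)
    · exfalso
      omega

theorem AffineMarks.exists_third (h : AffineMarks N m) {z a b : V} (hab : a ≠ b) (ha : a ∈ N z)
    (hb : b ∈ N z) (hlt : m a + m b ≠ 2 * m z) : ∃ c ∈ N z, c ≠ a ∧ c ≠ b := by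
  by_contra hall
  push Not at hall
  have hN : N z = {a, b} := by
    ext x
    rw [Finset.mem_insert, Finset.mem_singleton]
    refine ⟨fun hx => ?_, ?_⟩
    · by_cases hxa : x = a
      · exact Or.inl hxa
      · exact Or.inr (hall x hx hxa)
    · rintro (rfl | rfl) <;> assumption
  have hs := h.sum z
  rw [hN, Finset.sum_pair hab] at hs
  exact hlt hs

theorem AffineMarks.exists_second (h : AffineMarks N m) {z a : V} (hlt : m a ≠ 2 * m z) :
    ∃ b ∈ N z, b ≠ a := by
  by_contra hall
  push Not at hall
  have hs := h.sum z
  by_cases ha : a ∈ N z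
  · have hN : N z = {a} := by
      ext x
      rw [Finset.mem_singleton]
      exact ⟨fun hx => hall x hx, fun hx => hx ▸ ha⟩
    rw [hN, Finset.sum_singleton] at hs
    exact hlt hs
  · have hN : N z = ∅ := by
      rw [Finset.eq_empty_iff_forall_notMem]
      exact fun x hx => ha (hall x hx ▸ hx)
    rw [hN, Finset.sum_empty] at hs
    have := h.pos z
    omega

theorem AffineMarks.dvd_of_adjacent_max (h : AffineMarks N m) {y e z w : V} (hy : N y = {e})
    (hmax : ∀ v, m v ≤ m z) (hw : w ∈ N z) (hmw : m w = m z) (v : V) : m y ∣ m v := by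
  obtain ⟨M₀, hM⟩ : ∃ M₀, M₀ = m z := ⟨_, rfl⟩
  have hpos := h.pos z
  rw [← hM] at hmw hmax hpos
  have hall : ∀ x, (m x = M₀ ∧ ∃ w ∈ N x, m w = M₀) ∨
      (2 * m x = M₀ ∧ ∃ u ∈ N x, m u = M₀ ∧ ∃ w ∈ N u, m w = M₀) := by
    refine h.conn _ ⟨z, Or.inl ⟨hM.symm, w, hw, hmw⟩⟩ ?_
    rintro x v (⟨hx, w, hw, hmw⟩ | ⟨hx, u, hu, hmu, hu'⟩) hv
    · by_cases hvM : m v = M₀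
      · exact Or.inl ⟨hvM, x, h.symm _ _ hv, hx⟩
      · right
        have hvw : w ≠ v := by rintro rfl; exact hvM hmw
        obtain ⟨c, hc, hcw, hcv⟩ := h.exists_third hvw hw hv (by omega)
        have h1 := h.le_two_mul (h.symm _ _ hv)
        have h2 := h.le_two_mul (h.symm _ _ hc)
        have h3 := h.sum_le (v := x) (S := {w, v, c}) (by
          intro t
          simp only [Finset.mem_insert, Finset.mem_singleton]
          rintro (rfl | rfl | rfl) <;> assumption)
        rw [Finset.sum_insert (by simp [hvw, hcw.symm]), Finset.sum_pair hcv.symm] at h3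
        exact ⟨by omega, x, h.symm _ _ hv, hx, w, hw, hmw⟩
    · have hN : N x = {u} := h.eq_of_sum_eq (S := {u}) (by simpa using hu)
        (by rw [Finset.sum_singleton]; omega)
      rw [hN, Finset.mem_singleton] at hv
      rw [hv]
      exact Or.inl ⟨hmu, hu'⟩
  have hs := h.sum y
  rw [hy, Finset.sum_singleton] at hs
  have hye : 2 * m y = M₀ := by
    rcases hall y with ⟨h1, -⟩ | ⟨h1, -⟩
    · have := hmax e
      omega
    · exact h1
  rcases hall v with ⟨h1, -⟩ | ⟨h1, -⟩
  · exact ⟨2, by omega⟩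
  · exact ⟨1, by omega⟩

theorem AffineMarks.dvd_of_four (h : AffineMarks N m) {y e z : V} (hy : N y = {e}) {a b c d : V}
    (ha : a ∈ N z) (hb : b ∈ N z) (hc : c ∈ N z) (hd : d ∈ N z) (hab : a ≠ b) (hac : a ≠ c)
    (had : a ≠ d) (hbc : b ≠ c) (hbd : b ≠ d) (hcd : c ≠ d) (v : V) : m y ∣ m v := by
  have h1 := h.le_two_mul (h.symm _ _ ha)
  have h2 := h.le_two_mul (h.symm _ _ hb)
  have h3 := h.le_two_mul (h.symm _ _ hc)
  have h4 := h.le_two_mul (h.symm _ _ hd)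
  have hS : ({a, b, c, d} : Finset V) ⊆ N z := by
    intro t
    simp only [Finset.mem_insert, Finset.mem_singleton]
    rintro (rfl | rfl | rfl | rfl) <;> assumption
  have hsum : ∑ x ∈ ({a, b, c, d} : Finset V), m x = m a + (m b + (m c + m d)) := by
    rw [Finset.sum_insert (by simp [hab, hac, had]), Finset.sum_insert (by simp [hbc, hbd]),
      Finset.sum_pair hcd]
  have h5 := h.sum_le hS
  rw [hsum] at h5
  have hN := h.eq_of_sum_eq hS (by rw [hsum]; omega)
  have hhalf : ∀ x ∈ N z, 2 * m x = m z := by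
    intro x hx
    rw [hN] at hx
    simp only [Finset.mem_insert, Finset.mem_singleton] at hx
    rcases hx with rfl | rfl | rfl | rfl <;> omega
  have hall : ∀ x, x = z ∨ x ∈ N z := by
    refine h.conn _ ⟨z, Or.inl rfl⟩ ?_
    rintro x w (rfl | hx) hw
    · exact Or.inr hw
    · have hNx : N x = {z} := h.eq_of_sum_eq (by simpa using h.symm _ _ hx)
        (by rw [Finset.sum_singleton, hhalf x hx])
      rw [hNx, Finset.mem_singleton] at hw
      exact Or.inl hw
  have hmy : 2 * m y = m z := by
    rcases hall y with hyz | hyz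
    · exact absurd hyz.symm (leaf_ne hy ha hb hab)
    · exact hhalf y hyz
  rcases hall v with rfl | hv
  · exact ⟨2, by omega⟩
  · have := hhalf v hv
    exact ⟨1, by omega⟩

/-- A graph with affine marks having a leaf whose mark does not divide all marks is an affine
diagram of type `E₇` or `E₈`, the leaf being the end of a shorter arm. -/
theorem AffineMarks.classify [Finite V] (h : AffineMarks N m) {y e : V} (hy : N y = {e})
    (hdvd : ¬ ∀ v, m y ∣ m v) :
    (∃ f : Fin 8 → V, IsLabelling N affE7Adj f ∧ f 7 = y) ∨
    (∃ f : Fin 9 → V, IsLabelling N affE8Adj f ∧ (f 7 = y ∨ f 8 = y)) := by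
  have : Nonempty V := ⟨y⟩
  obtain ⟨z, hmax⟩ := Finite.exists_max m
  by_cases hw : ∃ w ∈ N z, m w = m z
  · obtain ⟨w, hw, hmw⟩ := hw
    exact absurd (h.dvd_of_adjacent_max hy hmax hw hmw) hdvd
  push Not at hw
  have hlt : ∀ v ∈ N z, m v < m z := fun v hv => lt_of_le_of_ne (hmax v) (hw v hv)
  have hz0 := h.pos z
  have hmz := hmax z
  obtain ⟨a, ha, -⟩ := h.exists_second (z := z) (a := z) (by omega)
  have hma := hlt a ha
  obtain ⟨b, hb, hba⟩ := h.exists_second (z := z) (a := a) (by omega)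
  have hmb := hlt b hb
  obtain ⟨c, hc, hcb, hca⟩ := h.exists_third hba hb ha (by omega)
  have hmc := hlt c hc
  by_cases hd : ∃ d ∈ N z, d ≠ a ∧ d ≠ b ∧ d ≠ c
  · obtain ⟨d, hd, hda, hdb, hdc⟩ := hd
    exact absurd (h.dvd_of_four hy ha hb hc hd hba.symm hca.symm hda.symm hcb.symm hdb.symm
      hdc.symm) hdvd
  push Not at hd
  have hN : ∀ t, t ∈ N z ↔ t = a ∨ t = b ∨ t = c := by
    intro t
    refine ⟨fun ht => ?_, ?_⟩
    · have := hd t ht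
      tauto
    · rintro (rfl | rfl | rfl) <;> assumption
  have key : ∀ p q r : V, (∀ t, (t = a ∨ t = b ∨ t = c) ↔ (t = p ∨ t = q ∨ t = r)) →
      p ≠ q → p ≠ r → q ≠ r → m p ≤ m q → m q ≤ m r → m r < m z → _ :=
    fun p q r hpqr h1 h2 h3 h4 h5 h6 => h.classify_sorted hy hdvd (z := z) (a₁ := p) (b₁ := q)
      (c₁ := r) (by ext t; simp [hN, hpqr]) h1 h2 h3 h4 h5 h6
  rcases le_total (m a) (m b) with h1 | h1 <;> rcases le_total (m b) (m c) with h2 | h2 <;>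
    rcases le_total (m a) (m c) with h3 | h3
  · exact key a b c (by tauto) hba.symm hca.symm hcb.symm h1 h2 hmc
  · exact key a b c (by tauto) hba.symm hca.symm hcb.symm h1 h2 hmc
  · exact key a c b (by tauto) hca.symm hba.symm hcb h3 h2 hmb
  · exact key c a b (by tauto) hca hcb hba.symm h3 h1 hmb
  · exact key b a c (by tauto) hba hcb.symm hca.symm h1 h3 hmc
  · exact key b c a (by tauto) hcb.symm hba hca h2 h3 hma
  · exact key c b a (by tauto) hcb hca hba h2 h1 hma
  · exact key c b a (by tauto) hcb hca hba h2 h1 hma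

end

/-- The Gram matrix of the affine diagram with the given adjacency. -/
def affGram {n : ℕ} (adj : Fin n → Fin n → Bool) : Matrix (Fin n) (Fin n) ℤ :=
  Matrix.of fun i j => if i = j then -2 else if adj i j = true then 1 else 0

section
variable {M : Type*} [AddCommGroup M] {D : M →ₗ[ℤ] M →ₗ[ℤ] ℤ}

theorem IsEvenNegDef.product_le_one (hD : IsEvenNegDef D) {r s : M} (hr : D r r = -2)
    (hs : D s s = -2) (hne : r ≠ -s) : D r s ≤ 1 := by
  by_contra hlt
  push Not at hlt
  apply hne
  rw [← add_eq_zero_iff_eq_neg]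
  apply hD.eq_zero
  simp only [map_add, LinearMap.add_apply, hD.symm s r]
  omega

/-- The graph of a family of vectors cannot be split into two orthogonal parts. -/
def IsConnectedFamily (D : M →ₗ[ℤ] M →ₗ[ℤ] ℤ) {ι : Type*} (b : ι → M) : Prop :=
  ∀ P : ι → Prop, (∃ i, P i) → (∀ i j, P i → i ≠ j → D (b i) (b j) ≠ 0 → P j) → ∀ i, P i

theorem IsSimpleFamily.mem_zero_one (hD : IsEvenNegDef D) {ι : Type*} {b : ι → M}
    (hb : IsSimpleFamily D b) {i j : ι} (hij : i ≠ j) : D (b i) (b j) = 0 ∨ D (b i) (b j) = 1 := by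
  have h1 := hb.nonneg i j hij
  have h2 : D (b i) (b j) ≤ 1 := by
    refine hD.product_le_one (hb.root i) (hb.root j) fun h => ?_
    have h3 := h1
    rw [h, map_neg, LinearMap.neg_apply, hb.root] at h3
    have h4 : LinearIndependent ℤ ![b i, b j] := by
      have := hb.li.comp ![i, j] (by
        intro x y hxy
        fin_cases x <;> fin_cases y <;> simp_all)
      convert this using 1
      ext k
      fin_cases k <;> rfl
    have h5 := LinearIndependent.pair_iff.mp h4 1 1 (by rw [h]; simp)
    exact one_ne_zero h5.1
  omega

/-- A vector of a finite family in a connected simple system pairs with at least two members of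
norm two only if it is an integral combination. -/
theorem exists_connecting_sum (hD : IsEvenNegDef D) {ι : Type*} [DecidableEq ι] {b : ι → M}
    (hb : IsSimpleFamily D b) (hconn : IsConnectedFamily D b) (i j : ι) :
    ∃ S : Finset ι, i ∈ S ∧ j ∈ S ∧ -2 ≤ D (∑ k ∈ S, b k) (∑ k ∈ S, b k) := by
  revert j
  refine hconn _ ⟨i, {i}, by simp, by simp, by simp [hb.root]⟩ ?_
  rintro j k ⟨S, hi, hj, hS⟩ hjk hne
  by_cases hk : k ∈ S
  · exact ⟨S, hi, hk, hS⟩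
  refine ⟨insert k S, by simp [hi], by simp, ?_⟩
  rw [Finset.sum_insert hk]
  have h1 : D (b j) (b k) ≤ D (∑ l ∈ S, b l) (b k) := by
    rw [map_sum, LinearMap.sum_apply]
    exact Finset.single_le_sum (f := fun l => D (b l) (b k))
      (fun l hl => hb.nonneg l k (by rintro rfl; exact hk hl)) hj
  have h2 := hb.nonneg j k hjk
  simp only [map_add, LinearMap.add_apply, hD.symm (b k) (∑ l ∈ S, b l), hb.root]
  omega

theorem neg_coeffs_of_dominant (hD : IsEvenNegDef D) {ι : Type*} [Fintype ι] {b : ι → M}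
    (hb : IsSimpleFamily D b) (n : ι → ℤ) (hdom : ∀ i, 0 ≤ D (∑ j, n j • b j) (b i)) (i : ι) :
    n i ≤ 0 := by
  set p := ∑ i, (n i)⁺ • b i with hp
  set q := ∑ i, (n i)⁻ • b i with hq
  have hpq : ∑ i, n i • b i = p - q := by
    rw [hp, hq, ← Finset.sum_sub_distrib]
    exact Finset.sum_congr rfl fun i _ => by rw [← sub_smul, posPart_sub_negPart]
  have hcross : 0 ≤ D q p := by
    rw [hq, dual_sum]
    refine Finset.sum_nonneg fun i _ => ?_
    rw [hp, sum_dual, Finset.mul_sum]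
    refine Finset.sum_nonneg fun j _ => ?_
    by_cases hij : i = j
    · subst hij
      rcases le_total 0 (n i) with h0 | h0
      · simp [negPart_eq_zero.mpr h0]
      · simp [posPart_eq_zero.mpr h0]
    · exact mul_nonneg (negPart_nonneg _) (mul_nonneg (posPart_nonneg _) (hb.nonneg i j hij))
  have h1 : 0 ≤ D (∑ i, n i • b i) p := by
    rw [hp, sum_dual]
    exact Finset.sum_nonneg fun i _ => mul_nonneg (posPart_nonneg _) (hdom i)
  rw [hpq, map_sub, LinearMap.sub_apply] at h1
  have hp0 : p = 0 := hD.eq_zero (by omega)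
  exact posPart_eq_zero.mp (Fintype.linearIndependent_iff.mp hb.li _ hp0 i)

theorem neg_coeffs_of_dominant_strict (hD : IsEvenNegDef D) {ι : Type*} [Fintype ι] {b : ι → M}
    (hb : IsSimpleFamily D b) (hconn : IsConnectedFamily D b) (n : ι → ℤ)
    (hdom : ∀ i, 0 ≤ D (∑ j, n j • b j) (b i)) (hn : n ≠ 0) (i : ι) : n i < 0 := by
  classical
  have hle := neg_coeffs_of_dominant hD hb n hdom
  obtain ⟨i₀, hi₀⟩ := Function.ne_iff.mp hn
  refine hconn (fun i => n i < 0) ⟨i₀, lt_of_le_of_ne (hle i₀) hi₀⟩ ?_ i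
  intro i j hi hij hne
  by_contra hj
  have hj0 : n j = 0 := by have := hle j; omega
  have h1 := hdom j
  rw [dual_sum, ← Finset.sum_erase_add _ _ (Finset.mem_univ i)] at h1
  have h2 : ∑ x ∈ Finset.univ.erase i, n x * D (b x) (b j) ≤ 0 := by
    refine Finset.sum_nonpos fun x _ => ?_
    by_cases hx : x = j
    · rw [hx, hj0, zero_mul]
    · exact mul_nonpos_of_nonpos_of_nonneg (hle x) (hb.nonneg x j hx)
  have h3 := hb.nonneg i j hij
  have h4 : n i * D (b i) (b j) < 0 := mul_neg_of_neg_of_pos hi (by omega)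
  omega

/-- A root outside the span of a connected simple family `b`, but in its rational span, that lies
in the chamber of `b`, is attached to `b` as in an affine diagram of type `E₇` or `E₈`. -/
theorem glue_classification (hD : IsEvenNegDef D) {ι : Type*} [Fintype ι] {b : ι → M}
    (hb : IsSimpleFamily D b) (hconn : IsConnectedFamily D b) {y : M} (hy : D y y = -2)
    (hyn : y ∉ Submodule.span ℤ (Set.range b)) {c : ℤ} (hc : c ≠ 0)
    (hcy : c • y ∈ Submodule.span ℤ (Set.range b)) (hdom : ∀ i, 0 ≤ D y (b i)) :
    (∃ u : Fin 8 → M, Function.Injective u ∧ gram D u = affGram affE7Adj ∧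
      Set.range u = insert y (Set.range b) ∧ u 7 = y) ∨
    (∃ u : Fin 9 → M, Function.Injective u ∧ gram D u = affGram affE8Adj ∧
      Set.range u = insert y (Set.range b) ∧ (u 7 = y ∨ u 8 = y)) := by
  classical
  wlog hc0 : 0 < c generalizing c
  · refine this (c := -c) (by omega) ?_ (by omega)
    rw [neg_smul]
    exact neg_mem hcy
  obtain ⟨n, hn⟩ := mem_span_range hcy
  have hn0 : n ≠ 0 := by
    rintro rfl
    have : c • y = 0 := by rw [← hn]; simp
    have := hD.eq_zero_of_ne_zero_smul hc this
    rw [this] at hy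
    simp at hy
  have hneg := neg_coeffs_of_dominant_strict hD hb hconn n (fun i => by
    rw [hn, map_smul, LinearMap.smul_apply, smul_eq_mul]
    exact mul_nonneg hc0.le (hdom i)) hn0
  have hbS : ∀ i, b i ∈ Submodule.span ℤ (Set.range b) := fun i => Submodule.subset_span ⟨i, rfl⟩
  let vec : Option ι → M := fun v => v.elim y b
  have hvec0 : vec none = y := rfl
  have hvec1 : ∀ i, vec (some i) = b i := fun _ => rfl
  have hroot : ∀ v, D (vec v) (vec v) = -2 := by
    rintro (_ | i)
    · exact hy
    · exact hb.root i
  have hy01 : ∀ i, D y (b i) = 0 ∨ D y (b i) = 1 := fun i => by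
    have h1 := hdom i
    have h2 := hD.product_le_one hy (hb.root i) (by
      intro h
      rw [h] at hyn
      exact hyn (neg_mem (hbS i)))
    omega
  have h01 : ∀ v w, v ≠ w → D (vec v) (vec w) = 0 ∨ D (vec v) (vec w) = 1 := by
    rintro (_ | i) (_ | j) hvw
    · exact absurd rfl hvw
    · exact hy01 j
    · rw [hD.symm]; exact hy01 i
    · exact hb.mem_zero_one hD (by rintro rfl; exact hvw rfl)
  have hinj : Function.Injective vec := by
    rintro (_ | i) (_ | j) hvw
    · rfl
    · rw [hvec0, hvec1] at hvw
      exact absurd (hvw ▸ hbS j) hyn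
    · rw [hvec0, hvec1] at hvw
      exact absurd (hvw ▸ hbS i) hyn
    · rw [hvec1, hvec1] at hvw
      rw [hb.li.injective hvw]
  let m : Option ι → ℤ := fun v => v.elim c (fun i => -n i)
  let N : Option ι → Finset (Option ι) := fun v =>
    Finset.univ.filter fun w => w ≠ v ∧ D (vec v) (vec w) ≠ 0
  have hN : ∀ v w, w ∈ N v ↔ w ≠ v ∧ D (vec v) (vec w) ≠ 0 := fun v w => by simp [N]
  have hmpos : ∀ v, 0 < m v := by
    rintro (_ | i)
    · exact hc0
    · have := hneg i
      change 0 < -n i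
      omega
  have hnull : ∑ v, m v • vec v = 0 := by
    rw [Fintype.sum_option]
    change c • y + ∑ i, (-n i) • b i = 0
    simp only [neg_smul, Finset.sum_neg_distrib, hn, add_neg_cancel]
  have hsum : ∀ v, ∑ w ∈ N v, m w = 2 * m v := by
    intro v
    have h1 : D (vec v) (∑ w, m w • vec w) = 0 := by rw [hnull, map_zero]
    rw [sum_dual, ← Finset.sum_erase_add _ _ (Finset.mem_univ v), hroot] at h1
    have h2 : ∑ w ∈ N v, m w = ∑ w ∈ Finset.univ.erase v, m w * D (vec v) (vec w) := by
      have hsub : N v ⊆ Finset.univ.erase v := fun w hw => by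
        rw [Finset.mem_erase]
        exact ⟨((hN v w).mp hw).1, Finset.mem_univ _⟩
      rw [← Finset.sum_subset hsub (f := fun w => m w * D (vec v) (vec w))]
      · refine Finset.sum_congr rfl fun w hw => ?_
        have hw' := (hN v w).mp hw
        rw [(h01 v w hw'.1.symm).resolve_left hw'.2, mul_one]
      · intro w hw hw'
        rw [hN] at hw'
        have hwv := (Finset.mem_erase.mp hw).1
        have : D (vec v) (vec w) = 0 := by
          by_contra h0
          exact hw' ⟨hwv, h0⟩
        rw [this, mul_zero]
    rw [h2]
    omega
  obtain ⟨e, he⟩ : ∃ e, D y (b e) ≠ 0 := by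
    by_contra hall
    push Not at hall
    have h1 := hsum none
    have h2 : N none = ∅ := by
      rw [Finset.eq_empty_iff_forall_notMem]
      rintro (_ | i) hi
      · exact ((hN _ _).mp hi).1 rfl
      · exact ((hN _ _).mp hi).2 (hall i)
    rw [h2, Finset.sum_empty] at h1
    have := hmpos none
    omega
  have huniq : ∀ i, D y (b i) ≠ 0 → i = e := by
    intro i hi
    by_contra hie
    obtain ⟨S, hiS, heS, hS⟩ := exists_connecting_sum hD hb hconn i e
    have h1 : 2 ≤ D y (∑ k ∈ S, b k) := by
      rw [map_sum]
      have h2 : ∑ k ∈ ({i, e} : Finset ι), D y (b k) ≤ ∑ k ∈ S, D y (b k) := by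
        refine Finset.sum_le_sum_of_subset_of_nonneg ?_ fun k _ _ => hdom k
        intro k
        rw [Finset.mem_insert, Finset.mem_singleton]
        rintro (rfl | rfl) <;> assumption
      rw [Finset.sum_pair hie, (hy01 i).resolve_left hi, (hy01 e).resolve_left he] at h2
      omega
    have h3 : y + ∑ k ∈ S, b k = 0 := by
      apply hD.eq_zero
      simp only [map_add, LinearMap.add_apply, hD.symm (∑ k ∈ S, b k) y, hy]
      omega
    apply hyn
    rw [eq_neg_of_add_eq_zero_left h3]
    exact neg_mem (Submodule.sum_mem _ fun k _ => hbS k)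
  have hNnone : N none = {some e} := by
    ext v
    rw [hN, Finset.mem_singleton]
    rcases v with _ | i
    · simp
    · constructor
      · rintro ⟨-, h⟩
        rw [huniq i h]
      · intro h
        rw [h]
        exact ⟨by simp, he⟩
  have hmarks : AffineMarks N m := by
    refine ⟨fun v w hw => ?_, fun v hv => ((hN v v).mp hv).1 rfl, hmpos, hsum, ?_⟩
    · rw [hN] at hw ⊢
      exact ⟨hw.1.symm, by rw [hD.symm]; exact hw.2⟩
    · intro P hP hstep
      have hsome : (∃ i, P (some i)) → ∀ i, P (some i) := fun h =>
        hconn (fun i => P (some i)) h fun i j hi hij hne =>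
          hstep (some i) (some j) hi ((hN _ _).mpr ⟨by simpa using Ne.symm hij, hne⟩)
      have hall : ∀ i, P (some i) := by
        apply hsome
        obtain ⟨_ | i, hv⟩ := hP
        · exact ⟨e, hstep none (some e) hv (by simp [hNnone])⟩
        · exact ⟨i, hv⟩
      rintro (_ | i)
      · exact hstep (some e) none (hall e)
          ((hN _ _).mpr ⟨by simp, by rw [hvec0, hvec1, hD.symm]; exact he⟩)
      · exact hall i
  have hdvd : ¬ ∀ v, m none ∣ m v := by
    intro h
    choose k hk using fun i => h (some i)
    apply hyn
    have h1 : c • (y + ∑ i, k i • b i) = 0 := by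
      rw [smul_add, ← hn, Finset.smul_sum, ← Finset.sum_add_distrib]
      refine Finset.sum_eq_zero fun i _ => ?_
      have h2 : -n i = c * k i := hk i
      rw [← mul_smul, ← h2, neg_smul, add_neg_cancel]
    have h2 := hD.eq_zero_of_ne_zero_smul hc h1
    rw [eq_neg_of_add_eq_zero_left h2]
    exact neg_mem (Submodule.sum_mem _ fun i _ => Submodule.smul_mem _ _ (hbS i))
  have hrange : Set.range vec = insert y (Set.range b) := by
    ext x
    constructor
    · rintro ⟨_ | i, rfl⟩
      · exact Or.inl rfl
      · exact Or.inr ⟨i, rfl⟩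
    · rintro (rfl | ⟨i, rfl⟩)
      · exact ⟨none, rfl⟩
      · exact ⟨some i, rfl⟩
  have htransfer : ∀ {k : ℕ} {adj : Fin k → Fin k → Bool} {f : Fin k → Option ι},
      IsLabelling N adj f → Function.Injective (vec ∘ f) ∧ gram D (vec ∘ f) = affGram adj ∧
      Set.range (vec ∘ f) = insert y (Set.range b) := by
    intro k adj f hf
    refine ⟨hinj.comp hf.inj, ?_, by rw [hf.surj.range_comp, hrange]⟩
    ext i j
    rw [gram, affGram, Matrix.of_apply, Matrix.of_apply, Function.comp_apply, Function.comp_apply]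
    by_cases hij : i = j
    · rw [if_pos hij, hij, hroot]
    · rw [if_neg hij]
      have hne : f i ≠ f j := fun h => hij (hf.inj h)
      have h1 := hf.mem_iff i j
      rw [hN] at h1
      by_cases h2 : adj i j = true
      · rw [if_pos h2]
        exact (h01 _ _ hne).resolve_left (h1.mpr h2).2
      · rw [if_neg h2]
        by_contra h3
        exact h2 (h1.mp ⟨hne.symm, h3⟩)
  rcases hmarks.classify hNnone hdvd with ⟨f, hf, h7⟩ | ⟨f, hf, h78⟩
  · left
    obtain ⟨h1, h2, h3⟩ := htransfer hf
    exact ⟨vec ∘ f, h1, h2, h3, by rw [Function.comp_apply, h7, hvec0]⟩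
  · right
    obtain ⟨h1, h2, h3⟩ := htransfer hf
    refine ⟨vec ∘ f, h1, h2, h3, ?_⟩
    rw [Function.comp_apply, Function.comp_apply]
    rcases h78 with h | h
    · left; rw [h, hvec0]
    · right; rw [h, hvec0]

end

section
variable {M : Type*} [AddCommGroup M] {D : M →ₗ[ℤ] M →ₗ[ℤ] ℤ}

theorem exists_isoToGram_family {S : Submodule ℤ M} {n : ℕ} {G : Matrix (Fin n) (Fin n) ℤ}
    (h : IsoToGram D S n G) : ∃ b : Fin n → M, Submodule.span ℤ (Set.range b) = S ∧
      gram D b = G := by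
  obtain ⟨f, -, hrange, hf⟩ := h
  refine ⟨fun i => f (Pi.single i 1), ?_, ?_⟩
  · rw [← hrange]
    have h1 : (Set.range fun i => f (Pi.single i 1)) =
        f '' Set.range (Pi.basisFun ℤ (Fin n)) := by
      rw [← Set.range_comp]
      congr 1
      ext i
      simp
    rw [h1, ← Submodule.map_span, Module.Basis.span_eq, Submodule.map_top]
  · ext i j
    rw [gram, Matrix.of_apply, hf]
    simp

theorem SubIsometric.exists_family {S T : Submodule ℤ M} (h : SubIsometric D S T) {ι : Type*}
    (b : ι → M) (hb : Submodule.span ℤ (Set.range b) = S) :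
    ∃ b' : ι → M, Submodule.span ℤ (Set.range b') = T ∧ gram D b' = gram D b := by
  obtain ⟨e, he⟩ := h
  have hmem : ∀ i, b i ∈ S := fun i => hb ▸ Submodule.subset_span ⟨i, rfl⟩
  refine ⟨fun i => (e ⟨b i, hmem i⟩ : M), ?_, ?_⟩
  · have h1 : Submodule.span ℤ (Set.range fun i => (⟨b i, hmem i⟩ : S)) = ⊤ := by
      apply Submodule.map_injective_of_injective S.injective_subtype
      rw [Submodule.map_span, ← Set.range_comp, Submodule.map_top, Submodule.range_subtype]
      exact hb
    have h2 : (Set.range fun i => (e ⟨b i, hmem i⟩ : M)) =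
        (T.subtype.comp e.toLinearMap) '' (Set.range fun i => (⟨b i, hmem i⟩ : S)) := by
      rw [← Set.range_comp]
      rfl
    rw [h2, ← Submodule.map_span, h1, Submodule.map_top, LinearMap.range_comp,
      LinearEquiv.range, Submodule.map_top, Submodule.range_subtype]
  · ext i j
    rw [gram, gram, Matrix.of_apply, Matrix.of_apply, he]

theorem subIsometric_symm {S T : Submodule ℤ M} (h : SubIsometric D S T) :
    SubIsometric D T S := by
  obtain ⟨e, he⟩ := h
  exact ⟨e.symm, fun x y => by rw [← he, e.apply_symm_apply, e.apply_symm_apply]⟩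

theorem exists_det_gram_eq {ι : Type*} [Fintype ι] [DecidableEq ι] {b b' : ι → M}
    (h : ∀ i, b' i ∈ Submodule.span ℤ (Set.range b)) :
    ∃ p : ℤ, (gram D b').det = p ^ 2 * (gram D b).det ∧
      (p ^ 2 = 1 → Submodule.span ℤ (Set.range b) = Submodule.span ℤ (Set.range b')) := by
  choose P hP using fun i => mem_span_range (h i)
  have hgram : gram D b' = Matrix.of P * gram D b * (Matrix.of P)ᵀ := by
    ext i j
    rw [gram, Matrix.of_apply, ← hP i, ← hP j, Matrix.mul_apply, sum_dual]
    refine Finset.sum_congr rfl fun k _ => ?_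
    rw [dual_sum, Matrix.mul_apply, Matrix.transpose_apply, Matrix.of_apply, mul_comm]
    rfl
  refine ⟨(Matrix.of P).det, ?_, fun hp => le_antisymm ?_ ?_⟩
  · rw [hgram, Matrix.det_mul, Matrix.det_mul, Matrix.det_transpose]
    ring
  · rw [Submodule.span_le]
    rintro _ ⟨k, rfl⟩
    have h1 : (Matrix.of P).adjugate * Matrix.of P = (Matrix.of P).det • 1 :=
      Matrix.adjugate_mul _
    have h2 : (Matrix.of P).det • ∑ i, (Matrix.of P).adjugate k i • b' i = b k := by
      have h3 : ∑ i, (Matrix.of P).adjugate k i • b' i =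
          ∑ j, ((Matrix.of P).adjugate * Matrix.of P) k j • b j := by
        simp only [Matrix.mul_apply, Finset.sum_smul, mul_smul]
        rw [Finset.sum_comm]
        refine Finset.sum_congr rfl fun i _ => ?_
        rw [← hP i, Finset.smul_sum]
        rfl
      rw [h3, h1]
      simp only [Matrix.smul_apply, Matrix.one_apply, smul_eq_mul, mul_ite, mul_one, mul_zero,
        ite_smul, zero_smul, Finset.sum_ite_eq, Finset.mem_univ, if_true, smul_smul]
      rw [← sq, hp, one_smul]
    rw [← h2]
    exact Submodule.smul_mem _ _ (Submodule.sum_mem _ fun i _ =>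
      Submodule.smul_mem _ _ (Submodule.subset_span ⟨i, rfl⟩))
  · rw [Submodule.span_le]
    rintro _ ⟨i, rfl⟩
    exact h i

theorem span_eq_of_det_gram_eq {ι : Type*} [Fintype ι] [DecidableEq ι] {b b' : ι → M}
    (h : ∀ i, b' i ∈ Submodule.span ℤ (Set.range b))
    (hdet : (gram D b').det = (gram D b).det) (h0 : (gram D b).det ≠ 0) :
    Submodule.span ℤ (Set.range b) = Submodule.span ℤ (Set.range b') := by
  obtain ⟨p, hp, hspan⟩ := exists_det_gram_eq (D := D) h
  apply hspan
  rw [hdet] at hp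
  exact mul_right_cancel₀ h0 (by rw [← hp, one_mul])

theorem det_gram_eq_of_span_eq (hD : IsEvenNegDef D) {ι : Type*} [Fintype ι] [DecidableEq ι]
    {b b' : ι → M} (hb : LinearIndependent ℤ b)
    (h : Submodule.span ℤ (Set.range b) = Submodule.span ℤ (Set.range b')) :
    (gram D b').det = (gram D b).det := by
  obtain ⟨p, hp, -⟩ := exists_det_gram_eq (D := D) (b := b) (b' := b')
    fun i => h ▸ Submodule.subset_span ⟨i, rfl⟩
  obtain ⟨q, hq, -⟩ := exists_det_gram_eq (D := D) (b := b') (b' := b)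
    fun i => h ▸ Submodule.subset_span ⟨i, rfl⟩
  have h0 := gram_det_ne_zero hD b hb
  have h1 : (q * p) ^ 2 = 1 := by
    apply mul_right_cancel₀ h0
    rw [hp] at hq
    linear_combination -hq
  have h2 : p ^ 2 = 1 := by
    rw [mul_pow] at h1
    exact Int.eq_one_of_mul_eq_one_left (sq_nonneg p) h1
  rw [hp, h2, one_mul]

theorem span_eq_of_det_gram_lt {ι : Type*} [Fintype ι] [DecidableEq ι]
    {b b' : ι → M} (h : ∀ i, b' i ∈ Submodule.span ℤ (Set.range b))
    (h0 : (gram D b').det ≠ 0) (hdet : |(gram D b').det| < 4) :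
    Submodule.span ℤ (Set.range b) = Submodule.span ℤ (Set.range b') := by
  obtain ⟨p, hp, hspan⟩ := exists_det_gram_eq (D := D) h
  apply hspan
  have hp0 : p ≠ 0 := by
    rintro rfl
    simp [hp] at h0
  have hd0 : (gram D b).det ≠ 0 := by
    intro h1
    simp [hp, h1] at h0
  rw [hp, abs_mul, abs_pow] at hdet
  have h1 : 1 ≤ |(gram D b).det| := Int.one_le_abs hd0
  have h2 : 1 ≤ |p| := Int.one_le_abs hp0
  have h3 : |p| < 2 := by nlinarith
  have h4 : |p| = 1 := by omega
  rw [← sq_abs, h4, one_pow]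

theorem card_eq_of_span_eq {ι κ : Type*} [Fintype ι] [Fintype κ] {b : ι → M} {b' : κ → M}
    (hb : LinearIndependent ℤ b) (hb' : LinearIndependent ℤ b')
    (h : Submodule.span ℤ (Set.range b) = Submodule.span ℤ (Set.range b')) :
    Fintype.card ι = Fintype.card κ := by
  rw [← finrank_span_eq_card hb, ← finrank_span_eq_card hb', h]

theorem finrank_eq_card [Module.Free ℤ M] [Module.Finite ℤ M] {ι : Type*}
    [Fintype ι] {b : ι → M} (hb : LinearIndependent ℤ b)
    (h : ∀ x : M, ∃ c : ℤ, c ≠ 0 ∧ c • x ∈ Submodule.span ℤ (Set.range b)) :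
    Module.finrank ℤ M = Fintype.card ι := by
  apply le_antisymm _ hb.fintype_card_le_finrank
  let g := Module.finBasis ℤ M
  choose c hc hcg using fun i => h (g i)
  have hli : LinearIndependent ℤ fun i =>
      (⟨c i • g i, hcg i⟩ : Submodule.span ℤ (Set.range b)) := by
    rw [Fintype.linearIndependent_iff]
    intro v hv i
    have h1 := congrArg Subtype.val hv
    simp only [AddSubmonoidClass.coe_finsetSum, SetLike.val_smul, ZeroMemClass.coe_zero,
      smul_smul] at h1
    exact (mul_eq_zero.mp (Fintype.linearIndependent_iff.mp g.linearIndependent _ h1 i)).resolve_right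
      (hc i)
  have h2 := hli.fintype_card_le_finrank
  rwa [Fintype.card_fin, finrank_span_eq_card hb] at h2

theorem isSimpleFamily_of_gram (hD : IsEvenNegDef D) {n : ℕ} {G : Matrix (Fin n) (Fin n) ℤ}
    (hdiag : ∀ i, G i i = -2) (hoff : ∀ i j, i ≠ j → 0 ≤ G i j) (hdet : G.det ≠ 0)
    {e : Fin n → M} (he : gram D e = G) : IsSimpleFamily D e := by
  subst he
  exact ⟨hdiag, hoff, li_of_gram_det_ne_zero hD e hdet⟩

theorem comp_perm_eq {n : ℕ} {G : Matrix (Fin n) (Fin n) ℤ} (hdet : G.det ≠ 0)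
    {σ : Equiv.Perm (Fin n)} (hσ : ∀ i j, G (σ i) (σ j) = G i j) {h t : Fin n → ℤ}
    (hGh : G *ᵥ h = t) (ht : ∀ i, t (σ i) = t i) (i : Fin n) : h (σ i) = h i := by
  have h1 : G *ᵥ (fun i => h (σ i) - h i) = 0 := by
    ext i
    have h2 : ∑ j, G i j * h j = t i := congrFun hGh i
    have h3 : ∑ j, G (σ i) j * h j = t (σ i) := congrFun hGh (σ i)
    rw [← Equiv.sum_comp σ] at h3
    simp only [hσ] at h3
    simp only [Matrix.mulVec, dotProduct, mul_sub, Finset.sum_sub_distrib, h2, h3, ht, sub_self,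
      Pi.zero_apply]
  have h2 := congrFun (Matrix.eq_zero_of_mulVec_eq_zero hdet h1) i
  exact sub_eq_zero.mp h2

theorem exists_weyl_perm (hD : IsEvenNegDef D) {n : ℕ} {e e' : Fin n → M}
    (he : IsSimpleFamily D e) (he' : IsSimpleFamily D e') (hgram : gram D e = gram D e')
    (hspan : Submodule.span ℤ (Set.range e) = Submodule.span ℤ (Set.range e')) :
    ∃ w ∈ weyl D, ∃ σ : Equiv.Perm (Fin n), (∀ i, w (e i) = e' (σ i)) ∧
      ∀ i j, gram D e' (σ i) (σ j) = gram D e' i j := by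
  obtain ⟨w, hw, hrange⟩ := exists_weyl_range_eq hD he he' hspan
  have h1 : ∀ i, ∃ j, e' j = w (e i) := fun i => by
    have : w (e i) ∈ Set.range e' := hrange ▸ ⟨i, rfl⟩
    exact this
  choose s hs using h1
  have hinj : Function.Injective s := fun i j hij =>
    he.li.injective (w.injective (by rw [← hs, ← hs, hij]))
  refine ⟨w, hw, Equiv.ofBijective s (Finite.injective_iff_bijective.mp hinj),
    fun i => (hs i).symm, fun i j => ?_⟩
  rw [← hgram]
  conv_lhs => rw [hgram]
  simp only [gram, Matrix.of_apply, Equiv.ofBijective_apply, hs, weyl_isometry hD hw]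

theorem exists_weyl_eq (hD : IsEvenNegDef D) {n : ℕ} {G : Matrix (Fin n) (Fin n) ℤ}
    (hdiag : ∀ i, G i i = -2) (hoff : ∀ i j, i ≠ j → 0 ≤ G i j) (hdet : G.det ≠ 0)
    {h : Fin n → ℤ} {t : ℤ} (hGh : G *ᵥ h = fun _ => t) (hinj : Function.Injective h)
    {e e' : Fin n → M} (he : gram D e = G) (he' : gram D e' = G)
    (hspan : Submodule.span ℤ (Set.range e) = Submodule.span ℤ (Set.range e')) :
    ∃ w ∈ weyl D, ∀ i, w (e i) = e' i := by
  obtain ⟨w, hw, σ, h1, h2⟩ := exists_weyl_perm hD (isSimpleFamily_of_gram hD hdiag hoff hdet he)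
    (isSimpleFamily_of_gram hD hdiag hoff hdet he') (he.trans he'.symm) hspan
  rw [he'] at h2
  refine ⟨w, hw, fun i => ?_⟩
  rw [h1, hinj (comp_perm_eq hdet h2 hGh (fun _ => rfl) i)]

theorem det_eq_of_mul_triangular {n : ℕ} {G : Matrix (Fin n) (Fin n) ℤ} (u l : Fin n → Fin n → ℤ)
    (h : G * Matrix.of u = Matrix.of l) (hu : ∀ i j, j < i → u i j = 0)
    (hl : ∀ i j, i < j → l i j = 0) (hu0 : ∏ i, u i i ≠ 0) {d : ℤ}
    (hd : ∏ i, l i i = d * ∏ i, u i i) : G.det = d := by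
  have h1 := congrArg Matrix.det h
  rw [Matrix.det_mul, Matrix.det_of_isUpperTriangular (M := Matrix.of u) (fun i j hij => hu i j hij),
    Matrix.det_of_isLowerTriangular (Matrix.of l) (fun i j hij => hl i j hij)] at h1
  simp only [Matrix.of_apply] at h1
  rw [hd] at h1
  exact mul_right_cancel₀ hu0 h1

end

theorem det_aGram_seven : (aGram 7).det = -8 := by
  refine det_eq_of_mul_triangular
    (![![1, 1, 1, 1, 1, 1, 1],
    ![0, 2, 2, 2, 2, 2, 2],
    ![0, 0, 3, 3, 3, 3, 3],
    ![0, 0, 0, 4, 4, 4, 4],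
    ![0, 0, 0, 0, 5, 5, 5],
    ![0, 0, 0, 0, 0, 6, 6],
    ![0, 0, 0, 0, 0, 0, 7]])
    (![![-2, 0, 0, 0, 0, 0, 0],
    ![1, -3, 0, 0, 0, 0, 0],
    ![0, 2, -4, 0, 0, 0, 0],
    ![0, 0, 3, -5, 0, 0, 0],
    ![0, 0, 0, 4, -6, 0, 0],
    ![0, 0, 0, 0, 5, -7, 0],
    ![0, 0, 0, 0, 0, 6, -8]])
    ?_ ?_ ?_ ?_ ?_ <;> decide +kernel

theorem det_aGram_eight : (aGram 8).det = 9 := by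
  refine det_eq_of_mul_triangular
    (![![1, 1, 1, 1, 1, 1, 1, 1],
    ![0, 2, 2, 2, 2, 2, 2, 2],
    ![0, 0, 3, 3, 3, 3, 3, 3],
    ![0, 0, 0, 4, 4, 4, 4, 4],
    ![0, 0, 0, 0, 5, 5, 5, 5],
    ![0, 0, 0, 0, 0, 6, 6, 6],
    ![0, 0, 0, 0, 0, 0, 7, 7],
    ![0, 0, 0, 0, 0, 0, 0, 8]])
    (![![-2, 0, 0, 0, 0, 0, 0, 0],
    ![1, -3, 0, 0, 0, 0, 0, 0],
    ![0, 2, -4, 0, 0, 0, 0, 0],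
    ![0, 0, 3, -5, 0, 0, 0, 0],
    ![0, 0, 0, 4, -6, 0, 0, 0],
    ![0, 0, 0, 0, 5, -7, 0, 0],
    ![0, 0, 0, 0, 0, 6, -8, 0],
    ![0, 0, 0, 0, 0, 0, 7, -9]])
    ?_ ?_ ?_ ?_ ?_ <;> decide +kernel

theorem det_aGram_nine : (aGram 9).det = -10 := by
  refine det_eq_of_mul_triangular
    (![![1, 1, 1, 1, 1, 1, 1, 1, 1],
    ![0, 2, 2, 2, 2, 2, 2, 2, 2],
    ![0, 0, 3, 3, 3, 3, 3, 3, 3],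
    ![0, 0, 0, 4, 4, 4, 4, 4, 4],
    ![0, 0, 0, 0, 5, 5, 5, 5, 5],
    ![0, 0, 0, 0, 0, 6, 6, 6, 6],
    ![0, 0, 0, 0, 0, 0, 7, 7, 7],
    ![0, 0, 0, 0, 0, 0, 0, 8, 8],
    ![0, 0, 0, 0, 0, 0, 0, 0, 9]])
    (![![-2, 0, 0, 0, 0, 0, 0, 0, 0],
    ![1, -3, 0, 0, 0, 0, 0, 0, 0],
    ![0, 2, -4, 0, 0, 0, 0, 0, 0],
    ![0, 0, 3, -5, 0, 0, 0, 0, 0],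
    ![0, 0, 0, 4, -6, 0, 0, 0, 0],
    ![0, 0, 0, 0, 5, -7, 0, 0, 0],
    ![0, 0, 0, 0, 0, 6, -8, 0, 0],
    ![0, 0, 0, 0, 0, 0, 7, -9, 0],
    ![0, 0, 0, 0, 0, 0, 0, 8, -10]])
    ?_ ?_ ?_ ?_ ?_ <;> decide +kernel

theorem det_dGram_nine : (dGram 9).det = -4 := by
  refine det_eq_of_mul_triangular
    (![![1, 0, 1, 1, 1, 1, 1, 1, 1],
    ![0, 1, 1, 1, 1, 1, 1, 1, 1],
    ![0, 0, 2, 2, 2, 2, 2, 2, 2],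
    ![0, 0, 0, 2, 2, 2, 2, 2, 2],
    ![0, 0, 0, 0, 2, 2, 2, 2, 2],
    ![0, 0, 0, 0, 0, 2, 2, 2, 2],
    ![0, 0, 0, 0, 0, 0, 2, 2, 2],
    ![0, 0, 0, 0, 0, 0, 0, 2, 2],
    ![0, 0, 0, 0, 0, 0, 0, 0, 2]])
    (![![-2, 0, 0, 0, 0, 0, 0, 0, 0],
    ![0, -2, 0, 0, 0, 0, 0, 0, 0],
    ![1, 1, -2, 0, 0, 0, 0, 0, 0],
    ![0, 0, 2, -2, 0, 0, 0, 0, 0],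
    ![0, 0, 0, 2, -2, 0, 0, 0, 0],
    ![0, 0, 0, 0, 2, -2, 0, 0, 0],
    ![0, 0, 0, 0, 0, 2, -2, 0, 0],
    ![0, 0, 0, 0, 0, 0, 2, -2, 0],
    ![0, 0, 0, 0, 0, 0, 0, 2, -2]])
    ?_ ?_ ?_ ?_ ?_ <;> decide +kernel

theorem det_eGram_seven : (eGram 7).det = -2 := by
  refine det_eq_of_mul_triangular
    (![![1, 1, 1, 1, 1, 1, 3],
    ![0, 2, 2, 2, 2, 2, 6],
    ![0, 0, 3, 3, 3, 3, 9],
    ![0, 0, 0, 4, 4, 4, 12],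
    ![0, 0, 0, 0, 5, 5, 8],
    ![0, 0, 0, 0, 0, 6, 4],
    ![0, 0, 0, 0, 0, 0, 7]])
    (![![-2, 0, 0, 0, 0, 0, 0],
    ![1, -3, 0, 0, 0, 0, 0],
    ![0, 2, -4, 0, 0, 0, 0],
    ![0, 0, 3, -5, 0, 0, 0],
    ![0, 0, 0, 4, -6, 0, 0],
    ![0, 0, 0, 0, 5, -7, 0],
    ![0, 0, 0, 4, 4, 4, -2]])
    ?_ ?_ ?_ ?_ ?_ <;> decide +kernel

theorem det_eGram_eight : (eGram 8).det = 1 := by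
  refine det_eq_of_mul_triangular
    (![![1, 1, 1, 1, 1, 1, 1, 3],
    ![0, 2, 2, 2, 2, 2, 2, 6],
    ![0, 0, 3, 3, 3, 3, 3, 9],
    ![0, 0, 0, 4, 4, 4, 4, 12],
    ![0, 0, 0, 0, 5, 5, 5, 15],
    ![0, 0, 0, 0, 0, 6, 6, 10],
    ![0, 0, 0, 0, 0, 0, 7, 5],
    ![0, 0, 0, 0, 0, 0, 0, 8]])
    (![![-2, 0, 0, 0, 0, 0, 0, 0],
    ![1, -3, 0, 0, 0, 0, 0, 0],
    ![0, 2, -4, 0, 0, 0, 0, 0],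
    ![0, 0, 3, -5, 0, 0, 0, 0],
    ![0, 0, 0, 4, -6, 0, 0, 0],
    ![0, 0, 0, 0, 5, -7, 0, 0],
    ![0, 0, 0, 0, 0, 6, -8, 0],
    ![0, 0, 0, 0, 5, 5, 5, -1]])
    ?_ ?_ ?_ ?_ ?_ <;> decide +kernel

theorem det_affGram_E8_D8 : (((affGram affE8Adj).submatrix ![0, 1, 2, 3, 4, 5, 6, 8] ![0, 1, 2, 3, 4, 5, 6, 8])).det = 4 := by
  refine det_eq_of_mul_triangular
    (![![1, 1, 1, 1, 1, 1, 1, 1],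
    ![0, 2, 2, 2, 2, 2, 2, 2],
    ![0, 0, 3, 3, 3, 3, 3, 3],
    ![0, 0, 0, 4, 4, 4, 4, 4],
    ![0, 0, 0, 0, 5, 5, 5, 5],
    ![0, 0, 0, 0, 0, 6, 6, 6],
    ![0, 0, 0, 0, 0, 0, 7, 3],
    ![0, 0, 0, 0, 0, 0, 0, 4]])
    (![![-2, 0, 0, 0, 0, 0, 0, 0],
    ![1, -3, 0, 0, 0, 0, 0, 0],
    ![0, 2, -4, 0, 0, 0, 0, 0],
    ![0, 0, 3, -5, 0, 0, 0, 0],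
    ![0, 0, 0, 4, -6, 0, 0, 0],
    ![0, 0, 0, 0, 5, -7, 0, 0],
    ![0, 0, 0, 0, 0, 6, -8, 0],
    ![0, 0, 0, 0, 0, 6, 6, -2]])
    ?_ ?_ ?_ ?_ ?_ <;> decide +kernel

theorem affGram_E7_submatrix :
    (affGram affE7Adj).submatrix ![0, 1, 2, 3, 4, 5, 7] ![0, 1, 2, 3, 4, 5, 7] = eGram 7 := by
  decide +kernel

theorem affGram_E8_submatrix : (affGram affE8Adj).submatrix
    ![1, 2, 3, 4, 5, 6, 7, 8] ![1, 2, 3, 4, 5, 6, 7, 8] = eGram 8 := by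
  decide +kernel

theorem affGram_E8_submatrix_A8 : (affGram affE8Adj).submatrix
    ![0, 1, 2, 3, 4, 5, 6, 7] ![0, 1, 2, 3, 4, 5, 6, 7] = aGram 8 := by
  decide +kernel

theorem affGram_E7_mulVec_marks : affGram affE7Adj *ᵥ ![1, 2, 3, 4, 3, 2, 1, 2] = 0 := by
  decide +kernel

theorem affGram_E8_mulVec_marks : affGram affE8Adj *ᵥ ![1, 2, 3, 4, 5, 6, 4, 2, 3] = 0 := by
  decide +kernel

theorem aGram_diag (n : ℕ) (i : Fin n) : aGram n i i = -2 := by simp [aGram]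

theorem aGram_nonneg (n : ℕ) {i j : Fin n} (h : i ≠ j) : 0 ≤ aGram n i j := by
  simp only [aGram, Matrix.of_apply, if_neg h]
  split_ifs <;> decide

theorem dGram_diag (n : ℕ) (i : Fin n) : dGram n i i = -2 := by simp [dGram]

theorem dGram_nonneg (n : ℕ) {i j : Fin n} (h : i ≠ j) : 0 ≤ dGram n i j := by
  simp only [dGram, Matrix.of_apply, if_neg h]
  split_ifs <;> decide

theorem eGram_diag (n : ℕ) (i : Fin n) : eGram n i i = -2 := by simp [eGram]

theorem eGram_nonneg (n : ℕ) {i j : Fin n} (h : i ≠ j) : 0 ≤ eGram n i j := by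
  simp only [eGram, Matrix.of_apply, if_neg h]
  split_ifs <;> decide

section Ranges

variable {M : Type*}

theorem range_eq_image_compl {ι κ : Type*} {u : κ → M} {b : ι → M} (hu : Function.Injective u)
    {k : κ} (hran : Set.range u = insert (u k) (Set.range b)) (hk : u k ∉ Set.range b) :
    Set.range b = u '' {k}ᶜ := by
  ext x
  constructor
  · intro hx
    have : x ∈ Set.range u := hran ▸ Set.mem_insert_of_mem _ hx
    obtain ⟨i, rfl⟩ := this
    exact ⟨i, fun h => hk (Set.mem_singleton_iff.mp h ▸ hx), rfl⟩
  · rintro ⟨i, hi, rfl⟩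
    have : u i ∈ insert (u k) (Set.range b) := hran ▸ Set.mem_range_self i
    exact this.resolve_left fun h => hi (hu h)

theorem card_eq_of_range_eq_insert {ι : Type*} [Fintype ι] {n : ℕ} {u : Fin (n + 1) → M}
    {b : ι → M} (hu : Function.Injective u) (hb : Function.Injective b) {y : M}
    (hran : Set.range u = insert y (Set.range b)) (hy : y ∉ Set.range b) : Fintype.card ι = n := by
  have h1 : (Set.range u).ncard = n + 1 := by
    rw [← Set.image_univ, Set.ncard_image_of_injective _ hu, Set.ncard_univ, Nat.card_eq_fintype_card,
      Fintype.card_fin]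
  have h2 : (Set.range b).ncard = Fintype.card ι := by
    rw [← Set.image_univ, Set.ncard_image_of_injective _ hb, Set.ncard_univ, Nat.card_eq_fintype_card]
  rw [hran, Set.ncard_insert_of_notMem hy (Set.finite_range b), h2] at h1
  exact Nat.succ_injective h1

theorem range_comp_A8 (u : Fin 9 → M) :
    Set.range (u ∘ ![0, 1, 2, 3, 4, 5, 6, 7]) = u '' {8}ᶜ := by
  rw [Set.range_comp]
  congr 1
  ext i
  simp only [Set.mem_range, Set.mem_compl_iff, Set.mem_singleton_iff]
  revert i
  decide

theorem range_comp_D8 (u : Fin 9 → M) :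
    Set.range (u ∘ ![0, 1, 2, 3, 4, 5, 6, 8]) = u '' {7}ᶜ := by
  rw [Set.range_comp]
  congr 1
  ext i
  simp only [Set.mem_range, Set.mem_compl_iff, Set.mem_singleton_iff]
  revert i
  decide

end Ranges

section AffineRigidity

variable {M : Type*} [AddCommGroup M] {D : M →ₗ[ℤ] M →ₗ[ℤ] ℤ}

/-- An isometry matching two affine families away from a node of mark `1` matches them there. -/
theorem map_eq_of_marks (hD : IsEvenNegDef D) {ι : Type*} [Fintype ι] [DecidableEq ι]
    {u u' : ι → M} {v : ι → ℤ} (hv : gram D u *ᵥ v = 0) (hv' : gram D u' *ᵥ v = 0) {k : ι}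
    (hk : v k = 1) (w : M ≃ₗ[ℤ] M) (hw : ∀ i, i ≠ k → w (u i) = u' i) (i : ι) :
    w (u i) = u' i := by
  by_cases hik : i = k
  · subst hik
    have h1 := congrArg w (sum_self_eq_zero hD u v hv)
    have h2 := sum_self_eq_zero hD u' v hv'
    rw [map_sum, map_zero, ← Finset.add_sum_erase _ _ (Finset.mem_univ i)] at h1
    rw [← Finset.add_sum_erase _ _ (Finset.mem_univ i)] at h2
    have h3 : ∑ x ∈ Finset.univ.erase i, w (v x • u x) = ∑ x ∈ Finset.univ.erase i, v x • u' x := by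
      refine Finset.sum_congr rfl fun x hx => ?_
      rw [map_zsmul, hw x (Finset.ne_of_mem_erase hx)]
    rw [h3, ← h2, hk, one_smul, one_smul] at h1
    exact add_right_cancel h1
  · exact hw i hik

theorem exists_weyl_eq_eGram_seven (hD : IsEvenNegDef D) {e e' : Fin 7 → M}
    (he : gram D e = eGram 7) (he' : gram D e' = eGram 7)
    (hspan : Submodule.span ℤ (Set.range e) = Submodule.span ℤ (Set.range e')) :
    ∃ w ∈ weyl D, ∀ i, w (e i) = e' i := by
  refine exists_weyl_eq hD (G := eGram 7) (h := ![27, 52, 75, 96, 66, 34, 49]) (t := -2)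
    (eGram_diag _) (fun _ _ => eGram_nonneg _) ?_ ?_ ?_ he he' hspan
  · rw [det_eGram_seven]; decide
  · decide +kernel
  · decide +kernel

theorem exists_weyl_eq_eGram_eight (hD : IsEvenNegDef D) {e e' : Fin 8 → M}
    (he : gram D e = eGram 8) (he' : gram D e' = eGram 8)
    (hspan : Submodule.span ℤ (Set.range e) = Submodule.span ℤ (Set.range e')) :
    ∃ w ∈ weyl D, ∀ i, w (e i) = e' i := by
  refine exists_weyl_eq hD (G := eGram 8) (h := ![29, 57, 84, 110, 135, 91, 46, 68]) (t := -1)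
    (eGram_diag _) (fun _ _ => eGram_nonneg _) ?_ ?_ ?_ he he' hspan
  · rw [det_eGram_eight]; decide
  · decide +kernel
  · decide +kernel

theorem gram_comp {ι κ : Type*} (u : ι → M) (φ : κ → ι) :
    gram D (u ∘ φ) = (gram D u).submatrix φ φ := rfl

theorem gram_affE7_comp {u : Fin 8 → M} (hu : gram D u = affGram affE7Adj) :
    gram D (u ∘ ![0, 1, 2, 3, 4, 5, 7]) = eGram 7 := by
  rw [gram_comp, hu, affGram_E7_submatrix]

theorem gram_affE8_comp {u : Fin 9 → M} (hu : gram D u = affGram affE8Adj) :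
    gram D (u ∘ ![1, 2, 3, 4, 5, 6, 7, 8]) = eGram 8 := by
  rw [gram_comp, hu, affGram_E8_submatrix]

theorem exists_weyl_eq_affE7 (hD : IsEvenNegDef D) {u u' : Fin 8 → M}
    (hu : gram D u = affGram affE7Adj) (hu' : gram D u' = affGram affE7Adj)
    (hspan : Submodule.span ℤ (Set.range (u ∘ ![0, 1, 2, 3, 4, 5, 7])) =
      Submodule.span ℤ (Set.range (u' ∘ ![0, 1, 2, 3, 4, 5, 7]))) :
    ∃ w ∈ weyl D, ∀ i, w (u i) = u' i := by
  obtain ⟨w, hw, hwe⟩ :=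
    exists_weyl_eq_eGram_seven hD (gram_affE7_comp hu) (gram_affE7_comp hu') hspan
  have hcov : ∀ i : Fin 8, i ≠ 6 →
      ∃ j : Fin 7, (![0, 1, 2, 3, 4, 5, 7] : Fin 7 → Fin 8) j = i := by decide
  refine ⟨w, hw, map_eq_of_marks hD (v := ![1, 2, 3, 4, 3, 2, 1, 2]) (k := 6) ?_ ?_ rfl w ?_⟩
  · rw [hu, affGram_E7_mulVec_marks]
  · rw [hu', affGram_E7_mulVec_marks]
  · intro i hi
    obtain ⟨j, rfl⟩ := hcov i hi
    exact hwe j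

theorem exists_weyl_eq_affE8 (hD : IsEvenNegDef D) {u u' : Fin 9 → M}
    (hu : gram D u = affGram affE8Adj) (hu' : gram D u' = affGram affE8Adj)
    (hspan : Submodule.span ℤ (Set.range (u ∘ ![1, 2, 3, 4, 5, 6, 7, 8])) =
      Submodule.span ℤ (Set.range (u' ∘ ![1, 2, 3, 4, 5, 6, 7, 8]))) :
    ∃ w ∈ weyl D, ∀ i, w (u i) = u' i := by
  obtain ⟨w, hw, hwe⟩ :=
    exists_weyl_eq_eGram_eight hD (gram_affE8_comp hu) (gram_affE8_comp hu') hspan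
  have hcov : ∀ i : Fin 9, i ≠ 0 →
      ∃ j : Fin 8, (![1, 2, 3, 4, 5, 6, 7, 8] : Fin 8 → Fin 9) j = i := by decide
  refine ⟨w, hw, map_eq_of_marks hD (v := ![1, 2, 3, 4, 5, 6, 4, 2, 3]) (k := 0) ?_ ?_ rfl w ?_⟩
  · rw [hu, affGram_E8_mulVec_marks]
  · rw [hu', affGram_E8_mulVec_marks]
  · intro i hi
    obtain ⟨j, rfl⟩ := hcov i hi
    exact hwe j

theorem span_range_eq_top_of_abs_det_lt [Module.Free ℤ M] [Module.Finite ℤ M] {n : ℕ}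
    (hn : Module.finrank ℤ M = n) {e : Fin n → M} (h0 : (gram D e).det ≠ 0)
    (hdet : |(gram D e).det| < 4) : Submodule.span ℤ (Set.range e) = ⊤ := by
  have hb := (Module.finBasisOfFinrankEq ℤ M hn).span_eq
  rw [← hb]
  exact (span_eq_of_det_gram_lt (fun i => hb ▸ Submodule.mem_top) h0 hdet).symm

/-- A connected configuration spanning a proper sublattice of finite index is obtained from an
affine diagram of type `E₇` or `E₈` by removing a node. -/
theorem exists_affine_of_saturated [Module.Free ℤ M] [Module.Finite ℤ M] (hD : IsEvenNegDef D)
    (hroot : Submodule.span ℤ {r : M | D r r = -2} = ⊤) {ι : Type*} [Fintype ι] {b : ι → M}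
    (hb : IsSimpleFamily D b) (hconn : IsConnectedFamily D b)
    (hne : Submodule.span ℤ (Set.range b) ≠ ⊤)
    (hsat : ∀ x : M, ∃ c : ℤ, c ≠ 0 ∧ c • x ∈ Submodule.span ℤ (Set.range b)) :
    (Module.finrank ℤ M = 7 ∧ ∃ u : Fin 8 → M, gram D u = affGram affE7Adj ∧
      Submodule.span ℤ (Set.range (u ∘ ![0, 1, 2, 3, 4, 5, 7])) = ⊤ ∧
      Set.range b = u '' {7}ᶜ) ∨
    (Module.finrank ℤ M = 8 ∧ ∃ u : Fin 9 → M, gram D u = affGram affE8Adj ∧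
      Submodule.span ℤ (Set.range (u ∘ ![1, 2, 3, 4, 5, 6, 7, 8])) = ⊤ ∧
      (Set.range b = u '' {7}ᶜ ∨ Set.range b = u '' {8}ᶜ)) := by
  have hex : ∃ r : M, D r r = -2 ∧ r ∉ Submodule.span ℤ (Set.range b) := by
    by_contra! hcon
    exact hne (top_le_iff.mp (hroot ▸ Submodule.span_le.mpr fun r hr => hcon r hr))
  obtain ⟨r, hr, hrn⟩ := hex
  obtain ⟨w, hw, hws, hdom⟩ := exists_dominant hD hb r
  have hwn : w r ∉ Submodule.span ℤ (Set.range b) := by rwa [mem_span_iff_of_sub_mem hws]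
  have hwn' : w r ∉ Set.range b := fun h => hwn (Submodule.subset_span h)
  obtain ⟨c, hc, hcw⟩ := hsat (w r)
  have hrank := finrank_eq_card hb.li hsat
  rcases glue_classification hD hb hconn (by rw [weyl_isometry hD hw, hr]) hwn hc hcw hdom with
    ⟨u, hinj, hu, hran, h7⟩ | ⟨u, hinj, hu, hran, h78⟩
  · rw [card_eq_of_range_eq_insert hinj hb.li.injective hran hwn'] at hrank
    rw [← h7] at hran hwn'
    refine Or.inl ⟨hrank, u, hu, span_range_eq_top_of_abs_det_lt (D := D) hrank ?_ ?_,
      range_eq_image_compl hinj hran hwn'⟩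
    · rw [gram_affE7_comp hu, det_eGram_seven]; decide
    · rw [gram_affE7_comp hu, det_eGram_seven]; decide
  · rw [card_eq_of_range_eq_insert hinj hb.li.injective hran hwn'] at hrank
    refine Or.inr ⟨hrank, u, hu, span_range_eq_top_of_abs_det_lt (D := D) hrank ?_ ?_, ?_⟩
    · rw [gram_affE8_comp hu, det_eGram_eight]; decide
    · rw [gram_affE8_comp hu, det_eGram_eight]; decide
    · rcases h78 with h | h
      · rw [← h] at hran hwn'
        exact Or.inl (range_eq_image_compl hinj hran hwn')
      · rw [← h] at hran hwn'
        exact Or.inr (range_eq_image_compl hinj hran hwn')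

theorem image_eq_of_map_eq {ι : Type*} {u u' : ι → M} {w : M ≃ₗ[ℤ] M}
    (h : ∀ i, w (u i) = u' i) (s : Set ι) : (fun x => w x) '' (u '' s) = u' '' s := by
  rw [Set.image_image]
  exact Set.image_congr fun i _ => h i

/-- The `A₈` and `D₈` sublattices of an affine `E₈` diagram are not isometric. -/
theorem not_subIsometric_affE8 (hD : IsEvenNegDef D) {u u' : Fin 9 → M}
    (hu : gram D u = affGram affE8Adj) (hu' : gram D u' = affGram affE8Adj)
    (h : SubIsometric D (Submodule.span ℤ (u '' {7}ᶜ)) (Submodule.span ℤ (u' '' {8}ᶜ))) :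
    False := by
  rw [← range_comp_A8, ← range_comp_D8] at h
  obtain ⟨b, hb, hbg⟩ := SubIsometric.exists_family h _ rfl
  have h1 : (gram D (u ∘ ![0, 1, 2, 3, 4, 5, 6, 8])).det = 4 := by
    rw [gram_comp, hu, det_affGram_E8_D8]
  have h2 : (gram D (u' ∘ ![0, 1, 2, 3, 4, 5, 6, 7])).det = 9 := by
    rw [gram_comp, hu', affGram_E8_submatrix_A8, det_aGram_eight]
  have h3 := det_gram_eq_of_span_eq hD
    (li_of_gram_det_ne_zero hD b (by rw [hbg, h1]; decide)) hb
  rw [hbg, h1, h2] at h3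
  exact absurd h3 (by decide)

theorem exists_weyl_image_eq_of_saturated [Module.Free ℤ M] [Module.Finite ℤ M]
    (hD : IsEvenNegDef D) (hroot : Submodule.span ℤ {r : M | D r r = -2} = ⊤)
    {ι κ : Type*} [Fintype ι] [Fintype κ] {b : ι → M} {c : κ → M}
    (hb : IsSimpleFamily D b) (hbconn : IsConnectedFamily D b)
    (hc : IsSimpleFamily D c) (hcconn : IsConnectedFamily D c)
    (hbne : Submodule.span ℤ (Set.range b) ≠ ⊤) (hcne : Submodule.span ℤ (Set.range c) ≠ ⊤)
    (hbsat : ∀ x : M, ∃ a : ℤ, a ≠ 0 ∧ a • x ∈ Submodule.span ℤ (Set.range b))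
    (hcsat : ∀ x : M, ∃ a : ℤ, a ≠ 0 ∧ a • x ∈ Submodule.span ℤ (Set.range c))
    (hiso : SubIsometric D (Submodule.span ℤ (Set.range b)) (Submodule.span ℤ (Set.range c))) :
    ∃ w ∈ weyl D, (fun x => w x) '' Set.range b = Set.range c := by
  rcases exists_affine_of_saturated hD hroot hb hbconn hbne hbsat with
    ⟨hn, u, hu, hus, hbu⟩ | ⟨hn, u, hu, hus, hbu⟩ <;>
  rcases exists_affine_of_saturated hD hroot hc hcconn hcne hcsat with
    ⟨hn', u', hu', hus', hcu⟩ | ⟨hn', u', hu', hus', hcu⟩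
  · obtain ⟨w, hw, hwu⟩ := exists_weyl_eq_affE7 hD hu hu' (hus.trans hus'.symm)
    exact ⟨w, hw, by rw [hbu, hcu, image_eq_of_map_eq hwu]⟩
  · omega
  · omega
  · obtain ⟨w, hw, hwu⟩ := exists_weyl_eq_affE8 hD hu hu' (hus.trans hus'.symm)
    refine ⟨w, hw, ?_⟩
    rcases hbu with hbu | hbu <;> rcases hcu with hcu | hcu
    · rw [hbu, hcu, image_eq_of_map_eq hwu]
    · rw [hbu, hcu] at hiso
      exact (not_subIsometric_affE8 hD hu hu' hiso).elim
    · rw [hbu, hcu] at hiso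
      exact (not_subIsometric_affE8 hD hu' hu (subIsometric_symm hiso)).elim
    · rw [hbu, hcu, image_eq_of_map_eq hwu]

end AffineRigidity

section AttachedRoot

variable {M : Type*} [AddCommGroup M] {D : M →ₗ[ℤ] M →ₗ[ℤ] ℤ}

/-- In an irreducible root lattice, a configuration of non-maximal rank can be extended by a root
which meets it nontrivially. -/
theorem exists_attached_root (hD : IsEvenNegDef D)
    (hroot : Submodule.span ℤ {r : M | D r r = -2} = ⊤)
    (hirr : ¬ ∃ S T : Set M, S ∪ T = {r : M | D r r = -2} ∧ S.Nonempty ∧ T.Nonempty ∧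
        S ∩ T = ∅ ∧ ∀ s ∈ S, ∀ t ∈ T, D s t = 0)
    {ι : Type*} [Fintype ι] [Nonempty ι] {e : ι → M} (he : IsSimpleFamily D e)
    (hns : ¬ ∀ x : M, ∃ c : ℤ, c ≠ 0 ∧ c • x ∈ Submodule.span ℤ (Set.range e)) :
    ∃ z : M, D z z = -2 ∧ (∀ c : ℤ, c • z ∈ Submodule.span ℤ (Set.range e) → c = 0) ∧
      (∀ i, D z (e i) = 0 ∨ D z (e i) = 1) ∧ ∃ i, D z (e i) = 1 := by
  set E := Submodule.span ℤ (Set.range e) with hE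
  have hex : ∃ s t : M, D t t = -2 ∧ (∃ c : ℤ, c ≠ 0 ∧ c • s ∈ E) ∧
      (∀ c : ℤ, c • t ∈ E → c = 0) ∧ D s t ≠ 0 := by
    by_contra! hcon
    refine hirr ⟨{r | D r r = -2 ∧ ∃ c : ℤ, c ≠ 0 ∧ c • r ∈ E},
      {r | D r r = -2 ∧ ∀ c : ℤ, c • r ∈ E → c = 0}, ?_, ?_, ?_, ?_, ?_⟩
    · ext r
      simp only [Set.mem_union, Set.mem_ofPred_eq]
      constructor
      · rintro (h | h) <;> exact h.1
      · intro h
        by_cases hr : ∃ c : ℤ, c ≠ 0 ∧ c • r ∈ E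
        · exact Or.inl ⟨h, hr⟩
        · push Not at hr
          exact Or.inr ⟨h, fun c hc => by_contra fun h0 => hr c h0 hc⟩
    · inhabit ι
      exact ⟨e default, he.root _, 1, one_ne_zero,
        by rw [one_smul]; exact Submodule.subset_span ⟨_, rfl⟩⟩
    · by_contra hT
      rw [Set.not_nonempty_iff_eq_empty, Set.eq_empty_iff_forall_notMem] at hT
      refine hns fun x => ?_
      have hx : x ∈ Submodule.span ℤ {r : M | D r r = -2} := hroot ▸ Submodule.mem_top
      induction hx using Submodule.span_induction with
      | mem r hr =>
        by_contra! h
        exact hT r ⟨hr, fun c hc => by_contra fun h0 => h c h0 hc⟩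
      | zero => exact ⟨1, one_ne_zero, by simp⟩
      | add x y _ _ hx hy =>
        obtain ⟨c, hc, hcx⟩ := hx
        obtain ⟨d, hd, hdy⟩ := hy
        refine ⟨c * d, mul_ne_zero hc hd, ?_⟩
        have : (c * d) • (x + y) = d • (c • x) + c • (d • y) := by
          rw [smul_add, smul_smul, smul_smul, mul_comm d c]
        rw [this]
        exact E.add_mem (E.smul_mem _ hcx) (E.smul_mem _ hdy)
      | smul a x _ hx =>
        obtain ⟨c, hc, hcx⟩ := hx
        exact ⟨c, hc, by rw [smul_comm]; exact E.smul_mem _ hcx⟩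
    · rw [Set.eq_empty_iff_forall_notMem]
      rintro r ⟨⟨_, c, hc, hcr⟩, _, h⟩
      exact hc (h c hcr)
    · rintro s ⟨_, c, hc, hcs⟩ t ⟨ht, htn⟩
      exact hcon s t ht ⟨c, hc, hcs⟩ htn
  obtain ⟨s, t, ht, ⟨c, hc, hcs⟩, htn, hst⟩ := hex
  obtain ⟨w, hw, hwE, hdom⟩ := exists_dominant hD he t
  have hmem := mem_span_iff_of_sub_mem hwE
  have hz : D (w t) (w t) = -2 := by rw [weyl_isometry hD hw, ht]
  have hzn : ∀ c : ℤ, c • w t ∈ E → c = 0 := fun c h =>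
    htn c ((hmem _).mp (by rwa [map_zsmul]))
  have h01 : ∀ i, D (w t) (e i) = 0 ∨ D (w t) (e i) = 1 := by
    intro i
    have h1 := hdom i
    have h2 : D (w t) (e i) ≤ 1 := hD.product_le_one hz (he.root i) fun h => by
      have := hzn 1 (by
        rw [one_smul, h]
        exact E.neg_mem (Submodule.subset_span ⟨i, rfl⟩))
      exact one_ne_zero this
    omega
  refine ⟨w t, hz, hzn, h01, ?_⟩
  by_contra! hcon
  have h0 : ∀ i, D (w t) (e i) = 0 := fun i => (h01 i).resolve_right (hcon i)
  have hcs' : w (c • s) ∈ E := (hmem _).mpr hcs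
  obtain ⟨v, hv⟩ := mem_span_range hcs'
  have h1 : D (w t) (w (c • s)) = 0 := by
    rw [← hv, sum_dual]
    exact Finset.sum_eq_zero fun i _ => by rw [h0, mul_zero]
  rw [weyl_isometry hD hw, map_zsmul, smul_eq_mul, hD.symm] at h1
  exact hst ((mul_eq_zero.mp h1).resolve_left hc)

theorem quadratic_form_lt_of_attached (hD : IsEvenNegDef D) {ι : Type*} [Fintype ι]
    [DecidableEq ι] {G H : Matrix ι ι ℤ} {d : ℤ} (hd : 0 < d) (hGH : G * H = (-d) • 1)
    {e : ι → M} (he : gram D e = G) {z : M} (hz : D z z = -2)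
    (hzn : ∀ c : ℤ, c • z ∈ Submodule.span ℤ (Set.range e) → c = 0) :
    (fun i => D z (e i)) ⬝ᵥ H *ᵥ (fun i => D z (e i)) < 2 * d := by
  set t : ι → ℤ := fun i => D z (e i) with ht
  set y : M := ∑ i, (H *ᵥ t) i • e i with hy
  have hyE : y ∈ Submodule.span ℤ (Set.range e) :=
    Submodule.sum_mem _ fun i _ => Submodule.smul_mem _ _ (Submodule.subset_span ⟨i, rfl⟩)
  have hyj : ∀ j, D y (e j) = -d * t j := by
    intro j
    rw [hy, dual_eq_gram_mulVec hD, he, Matrix.mulVec_mulVec, hGH, Matrix.smul_mulVec,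
      Matrix.one_mulVec, Pi.smul_apply, smul_eq_mul]
  have hzy : D z y = t ⬝ᵥ H *ᵥ t := by
    rw [hy, sum_dual, dotProduct]
    exact Finset.sum_congr rfl fun i _ => mul_comm _ _
  have hyy : D y y = -d * (t ⬝ᵥ H *ᵥ t) := by
    conv_lhs => rw [hy, sum_dual]
    rw [dotProduct, Finset.mul_sum]
    refine Finset.sum_congr rfl fun i _ => ?_
    rw [← hy, hyj]
    ring
  have hne : d • z + y ≠ 0 := fun h => by
    have : d • z = -y := eq_neg_of_add_eq_zero_left h
    exact hd.ne' (hzn d (this ▸ Submodule.neg_mem _ hyE))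
  have hneg := hD.neg _ hne
  have hexp : D (d • z + y) (d • z + y) = d * (d * -2) + d * D z y + (d * D z y + D y y) := by
    simp only [map_add, map_zsmul, LinearMap.add_apply, LinearMap.smul_apply, smul_eq_mul, hz,
      hD.symm y z]
    ring
  rw [hexp, hyy, hzy] at hneg
  nlinarith

theorem eq_single_of_quadratic_form_lt {ι : Type*} [Fintype ι] [DecidableEq ι]
    {H : Matrix ι ι ℤ} {N : ℤ} (hH : ∀ i j, 0 ≤ H i j)
    (hpair : ∀ i j, i ≠ j → N ≤ H i i + H i j + (H j i + H j j)) {t : ι → ℤ}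
    (ht : ∀ i, t i = 0 ∨ t i = 1) (hone : ∃ i, t i = 1) (hlt : t ⬝ᵥ H *ᵥ t < N) :
    ∃ i, t i = 1 ∧ (∀ j, j ≠ i → t j = 0) ∧ H i i < N := by
  obtain ⟨i, hi⟩ := hone
  have hnn : ∀ i, 0 ≤ t i := fun i => by rcases ht i with h | h <;> omega
  have hle : ∀ s : Finset ι, ∑ a ∈ s, ∑ b ∈ s, t a * (H a b * t b) ≤ t ⬝ᵥ H *ᵥ t := by
    intro s
    simp only [dotProduct, Matrix.mulVec, Finset.mul_sum]
    have hterm : ∀ a b, 0 ≤ t a * (H a b * t b) := fun a b =>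
      mul_nonneg (hnn a) (mul_nonneg (hH a b) (hnn b))
    calc ∑ a ∈ s, ∑ b ∈ s, t a * (H a b * t b)
        ≤ ∑ a ∈ s, ∑ b, t a * (H a b * t b) := Finset.sum_le_sum fun a _ =>
          Finset.sum_le_sum_of_subset_of_nonneg (Finset.subset_univ s) fun b _ _ => hterm a b
      _ ≤ ∑ a, ∑ b, t a * (H a b * t b) :=
          Finset.sum_le_sum_of_subset_of_nonneg (Finset.subset_univ s) fun a _ _ =>
            Finset.sum_nonneg fun b _ => hterm a b
  refine ⟨i, hi, fun j hj => (ht j).resolve_right fun h1 => ?_, ?_⟩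
  · have h2 := hle {i, j}
    rw [Finset.sum_pair hj.symm, Finset.sum_pair hj.symm, Finset.sum_pair hj.symm, hi, h1] at h2
    have h3 := hpair i j hj.symm
    simp only [one_mul, mul_one] at h2
    omega
  · have h2 := hle {i}
    rw [Finset.sum_singleton, Finset.sum_singleton, hi, one_mul, mul_one] at h2
    omega

end AttachedRoot

/-- `-2` times the inverse of the Gram matrix of `E₇`. -/
def eSevenAdjoint : Fin 7 → Fin 7 → ℤ :=
  ![![3, 4, 5, 6, 4, 2, 3],
    ![4, 8, 10, 12, 8, 4, 6],
    ![5, 10, 15, 18, 12, 6, 9],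
    ![6, 12, 18, 24, 16, 8, 12],
    ![4, 8, 12, 16, 12, 6, 8],
    ![2, 4, 6, 8, 6, 4, 4],
    ![3, 6, 9, 12, 8, 4, 7]]

/-- `-9` times the inverse of the Gram matrix of `A₈`. -/
def aEightAdjoint (i j : Fin 8) : ℤ :=
  (min i.val j.val + 1) * (8 - max i.val j.val)

theorem eGram_mul_eSevenAdjoint : eGram 7 * Matrix.of eSevenAdjoint = (-2 : ℤ) • 1 := by
  decide +kernel

theorem aGram_mul_aEightAdjoint : aGram 8 * Matrix.of aEightAdjoint = (-9 : ℤ) • 1 := by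
  decide +kernel

section Extensions

variable {M : Type*} [AddCommGroup M] {D : M →ₗ[ℤ] M →ₗ[ℤ] ℤ}

theorem isSimpleFamily_eGram_seven (hD : IsEvenNegDef D) {e : Fin 7 → M}
    (he : gram D e = eGram 7) : IsSimpleFamily D e :=
  isSimpleFamily_of_gram hD (eGram_diag 7) (fun _ _ => eGram_nonneg 7)
    (by rw [det_eGram_seven]; decide) he

theorem isSimpleFamily_aGram_eight (hD : IsEvenNegDef D) {e : Fin 8 → M}
    (he : gram D e = aGram 8) : IsSimpleFamily D e :=
  isSimpleFamily_of_gram hD (aGram_diag 8) (fun _ _ => aGram_nonneg 8)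
    (by rw [det_aGram_eight]; decide) he

theorem attached_eGram_seven (hD : IsEvenNegDef D) {e : Fin 7 → M} (he : gram D e = eGram 7)
    {z : M} (hz : D z z = -2)
    (hzn : ∀ c : ℤ, c • z ∈ Submodule.span ℤ (Set.range e) → c = 0)
    (h01 : ∀ i, D z (e i) = 0 ∨ D z (e i) = 1) (hone : ∃ i, D z (e i) = 1) (i : Fin 7) :
    D z (e i) = if i = 0 then 1 else 0 := by
  have hlt := quadratic_form_lt_of_attached hD (by decide) eGram_mul_eSevenAdjoint he hz hzn
  have hnn : ∀ i j, 0 ≤ eSevenAdjoint i j := by decide +kernel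
  have hpair : ∀ i j, i ≠ j → 2 * 2 ≤ eSevenAdjoint i i + eSevenAdjoint i j +
      (eSevenAdjoint j i + eSevenAdjoint j j) := by decide +kernel
  have hdiag : ∀ i, eSevenAdjoint i i < 2 * 2 → i = 0 := by decide +kernel
  obtain ⟨k, hk, hk0, hkN⟩ := eq_single_of_quadratic_form_lt hnn hpair h01 hone hlt
  obtain rfl := hdiag k hkN
  split_ifs with h
  · rw [h, hk]
  · exact hk0 i h

theorem attached_aGram_eight (hD : IsEvenNegDef D) {e : Fin 8 → M} (he : gram D e = aGram 8)
    {z : M} (hz : D z z = -2)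
    (hzn : ∀ c : ℤ, c • z ∈ Submodule.span ℤ (Set.range e) → c = 0)
    (h01 : ∀ i, D z (e i) = 0 ∨ D z (e i) = 1) (hone : ∃ i, D z (e i) = 1) :
    ∃ k : Fin 8, (k = 0 ∨ k = 1 ∨ k = 6 ∨ k = 7) ∧ ∀ i, D z (e i) = if i = k then 1 else 0 := by
  have hlt := quadratic_form_lt_of_attached hD (by decide) aGram_mul_aEightAdjoint he hz hzn
  have hnn : ∀ i j, 0 ≤ aEightAdjoint i j := by decide +kernel
  have hpair : ∀ i j, i ≠ j → 2 * 9 ≤ aEightAdjoint i i + aEightAdjoint i j +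
      (aEightAdjoint j i + aEightAdjoint j j) := by decide +kernel
  have hdiag : ∀ i, aEightAdjoint i i < 2 * 9 → (i = 0 ∨ i = 1 ∨ i = 6 ∨ i = 7) := by
    decide +kernel
  obtain ⟨k, hk, hk0, hkN⟩ := eq_single_of_quadratic_form_lt hnn hpair h01 hone hlt
  refine ⟨k, hdiag k hkN, fun i => ?_⟩
  split_ifs with h
  · rw [h, hk]
  · exact hk0 i h

theorem gram_vecCons (hD : IsEvenNegDef D) {n : ℕ} {e : Fin n → M} {z : M}
    {G : Matrix (Fin (n + 1)) (Fin (n + 1)) ℤ} (hsymm : ∀ i j, G i j = G j i)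
    (h0 : D z z = G 0 0) (hs : gram D e = G.submatrix Fin.succ Fin.succ)
    (hz : ∀ i, D z (e i) = G 0 i.succ) : gram D (Matrix.vecCons z e) = G := by
  ext i j
  simp only [gram, Matrix.of_apply]
  refine Fin.cases ?_ (fun i => ?_) i <;> refine Fin.cases ?_ (fun j => ?_) j
  · simpa using h0
  · simpa using hz j
  · simpa [hsymm i.succ 0, hD.symm (e i) z] using hz i
  · have := congrFun (congrFun hs i) j
    simpa [gram] using this

theorem aGram_symm (n : ℕ) (i j : Fin n) : aGram n i j = aGram n j i := by
  simp only [aGram, Matrix.of_apply, eq_comm (a := i), or_comm]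

theorem dGram_symm (n : ℕ) (i j : Fin n) : dGram n i j = dGram n j i := by
  simp only [dGram, Matrix.of_apply, eq_comm (a := i)]
  congr 1
  simp only [or_comm]

theorem eGram_symm (n : ℕ) (i j : Fin n) : eGram n i j = eGram n j i := by
  simp only [eGram, Matrix.of_apply, eq_comm (a := i), or_comm]

theorem not_saturated_of_card_lt [Module.Free ℤ M] [Module.Finite ℤ M] {ι : Type*} [Fintype ι]
    {e : ι → M} (he : LinearIndependent ℤ e) (hcard : Fintype.card ι ≠ Module.finrank ℤ M) :
    ¬ ∀ x : M, ∃ c : ℤ, c ≠ 0 ∧ c • x ∈ Submodule.span ℤ (Set.range e) :=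
  fun h => hcard (finrank_eq_card he h).symm

theorem exists_affE7_attached [Module.Free ℤ M] [Module.Finite ℤ M] (hD : IsEvenNegDef D)
    (hroot : Submodule.span ℤ {r : M | D r r = -2} = ⊤)
    (hirr : ¬ ∃ S T : Set M, S ∪ T = {r : M | D r r = -2} ∧ S.Nonempty ∧ T.Nonempty ∧
        S ∩ T = ∅ ∧ ∀ s ∈ S, ∀ t ∈ T, D s t = 0) (hrank : Module.finrank ℤ M = 8)
    {ι : Type*} [Fintype ι] {c : ι → M} (hc : IsSimpleFamily D c) (hconn : IsConnectedFamily D c)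
    {a q : Fin 7 → M} (ha : gram D a = aGram 7)
    (hac : Submodule.span ℤ (Set.range a) = Submodule.span ℤ (Set.range c))
    (hq : gram D q = eGram 7)
    (hqc : ∀ i, ∃ k : ℤ, k ≠ 0 ∧ k • q i ∈ Submodule.span ℤ (Set.range c))
    (hle : Submodule.span ℤ (Set.range c) ≤ Submodule.span ℤ (Set.range q)) :
    ∃ u : Fin 8 → M, gram D u = affGram affE7Adj ∧ Set.range c = u '' {7}ᶜ ∧
      ∃ z, gram D (Matrix.vecCons z (u ∘ ![0, 1, 2, 3, 4, 5, 7])) = eGram 8 := by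
  have hali : LinearIndependent ℤ a :=
    li_of_gram_det_ne_zero hD a (by rw [ha, det_aGram_seven]; decide)
  have hex : ∃ i, q i ∉ Submodule.span ℤ (Set.range c) := by
    by_contra! h
    have hspan : Submodule.span ℤ (Set.range a) = Submodule.span ℤ (Set.range q) := by
      rw [hac]
      exact le_antisymm hle (Submodule.span_le.mpr (Set.range_subset_iff.mpr h))
    have := det_gram_eq_of_span_eq hD hali hspan
    rw [ha, hq, det_aGram_seven, det_eGram_seven] at this
    exact absurd this (by decide)
  obtain ⟨i, hi⟩ := hex
  obtain ⟨w, hw, hwc, hdom⟩ := exists_dominant hD hc (q i)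
  obtain ⟨k, hk, hkq⟩ := hqc i
  have hyn : w (q i) ∉ Submodule.span ℤ (Set.range c) := by rwa [mem_span_iff_of_sub_mem hwc]
  have hyn' : w (q i) ∉ Set.range c := fun h => hyn (Submodule.subset_span h)
  have hy : D (w (q i)) (w (q i)) = -2 := by
    rw [weyl_isometry hD hw]
    exact (congrFun (congrFun hq i) i).trans (eGram_diag 7 i)
  have hky : k • w (q i) ∈ Submodule.span ℤ (Set.range c) := by
    rwa [← map_zsmul, mem_span_iff_of_sub_mem hwc]
  have hcard := card_eq_of_span_eq hali hc.li hac
  rw [Fintype.card_fin] at hcard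
  rcases glue_classification hD hc hconn hy hyn hk hky hdom with
    ⟨u, hinj, hu, hran, h7⟩ | ⟨u, hinj, hu, hran, -⟩
  · rw [← h7] at hran hyn'
    refine ⟨u, hu, range_eq_image_compl hinj hran hyn', ?_⟩
    have he := gram_affE7_comp hu
    have hes := isSimpleFamily_eGram_seven hD he
    obtain ⟨z, hz, hzn, h01, hone⟩ := exists_attached_root hD hroot hirr hes
      (not_saturated_of_card_lt hes.li (by rw [hrank, Fintype.card_fin]; decide))
    refine ⟨z, gram_vecCons hD (eGram_symm 8) (hz.trans (eGram_diag 8 0).symm) ?_ fun i => ?_⟩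
    · rw [he]
      decide +kernel
    · rw [attached_eGram_seven hD he hz hzn h01 hone]
      revert i
      decide +kernel
  · have := card_eq_of_range_eq_insert hinj hc.li.injective hran hyn'
    omega

theorem exists_weyl_image_eq_of_affE7_attached [Module.Free ℤ M] [Module.Finite ℤ M]
    (hD : IsEvenNegDef D) (hrank : Module.finrank ℤ M = 8) {u u' : Fin 8 → M} {z z' : M}
    (hu : gram D u = affGram affE7Adj) (hu' : gram D u' = affGram affE7Adj)
    (hz : gram D (Matrix.vecCons z (u ∘ ![0, 1, 2, 3, 4, 5, 7])) = eGram 8)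
    (hz' : gram D (Matrix.vecCons z' (u' ∘ ![0, 1, 2, 3, 4, 5, 7])) = eGram 8) :
    ∃ w ∈ weyl D, ∀ i, w (u i) = u' i := by
  have htop : ∀ {e : Fin 8 → M}, gram D e = eGram 8 →
      Submodule.span ℤ (Set.range e) = ⊤ := fun {e} he =>
    span_range_eq_top_of_abs_det_lt (D := D) hrank (by rw [he, det_eGram_eight]; decide)
      (by rw [he, det_eGram_eight]; decide)
  obtain ⟨w, hw, hwe⟩ :=
    exists_weyl_eq_eGram_eight hD hz hz' ((htop hz).trans (htop hz').symm)
  have hcov : ∀ i : Fin 8, i ≠ 6 →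
      ∃ j : Fin 7, (![0, 1, 2, 3, 4, 5, 7] : Fin 7 → Fin 8) j = i := by decide
  refine ⟨w, hw, map_eq_of_marks hD (v := ![1, 2, 3, 4, 3, 2, 1, 2]) (k := 6) ?_ ?_ rfl w ?_⟩
  · rw [hu, affGram_E7_mulVec_marks]
  · rw [hu', affGram_E7_mulVec_marks]
  · intro i hi
    obtain ⟨j, rfl⟩ := hcov i hi
    exact hwe j.succ

theorem range_eq_image_vecCons {α : Type*} {n : ℕ} (z : α) (e : Fin n → α) :
    Set.range e = Matrix.vecCons z e '' {0}ᶜ := by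
  ext x
  constructor
  · rintro ⟨i, rfl⟩
    exact ⟨i.succ, Fin.succ_ne_zero i, rfl⟩
  · rintro ⟨i, hi, rfl⟩
    obtain ⟨j, rfl⟩ := Fin.exists_succ_eq.mpr hi
    exact ⟨j, rfl⟩

theorem aGram_submatrix_rev (n : ℕ) : (aGram n).submatrix Fin.rev Fin.rev = aGram n := by
  ext i j
  simp only [aGram, Matrix.submatrix_apply, Matrix.of_apply, Fin.rev_inj, Fin.val_rev]
  congr 2
  apply propext
  omega

theorem exists_A9_or_D9 [Module.Free ℤ M] [Module.Finite ℤ M] (hD : IsEvenNegDef D)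
    (hroot : Submodule.span ℤ {r : M | D r r = -2} = ⊤)
    (hirr : ¬ ∃ S T : Set M, S ∪ T = {r : M | D r r = -2} ∧ S.Nonempty ∧ T.Nonempty ∧
        S ∩ T = ∅ ∧ ∀ s ∈ S, ∀ t ∈ T, D s t = 0) (hrank : Module.finrank ℤ M = 9)
    {ι : Type*} [Fintype ι] {c : ι → M} (hc : IsSimpleFamily D c) {a : Fin 8 → M}
    (ha : gram D a = aGram 8)
    (hac : Submodule.span ℤ (Set.range a) = Submodule.span ℤ (Set.range c)) :
    ∃ b : Fin 9 → M, (gram D b = aGram 9 ∨ gram D b = dGram 9) ∧ Set.range c = b '' {0}ᶜ := by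
  obtain ⟨w, hw, hwa⟩ := exists_weyl_range_eq hD (isSimpleFamily_aGram_eight hD ha) hc hac
  set v : Fin 8 → M := fun i => w (a i) with hv
  have hvg : gram D v = aGram 8 := by
    rw [← ha]
    ext i j
    exact weyl_isometry hD hw _ _
  have hvs := isSimpleFamily_aGram_eight hD hvg
  obtain ⟨z, hz, hzn, h01, hone⟩ := exists_attached_root hD hroot hirr hvs
    (not_saturated_of_card_lt hvs.li (by rw [hrank, Fintype.card_fin]; decide))
  obtain ⟨k, hk, hzk⟩ := attached_aGram_eight hD hvg hz hzn h01 hone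
  have hrev : ∃ v' : Fin 8 → M, gram D v' = aGram 8 ∧ Set.range v' = Set.range c ∧
      ∃ k : Fin 8, (k = 0 ∨ k = 1) ∧ ∀ i, D z (v' i) = if i = k then 1 else 0 := by
    have hrevran : Set.range (v ∘ Fin.rev) = Set.range c := by
      rw [Fin.rev_surjective.range_comp, hwa]
    have hrevg : gram D (v ∘ Fin.rev) = aGram 8 := by
      rw [gram_comp, hvg, aGram_submatrix_rev]
    have hrevz : ∀ i, D z ((v ∘ Fin.rev) i) = if i = k.rev then 1 else 0 := fun i => by
      rw [Function.comp_apply, hzk]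
      simp only [Fin.rev_eq_iff]
    rcases hk with rfl | rfl | rfl | rfl
    · exact ⟨v, hvg, hwa, 0, Or.inl rfl, hzk⟩
    · exact ⟨v, hvg, hwa, 1, Or.inr rfl, hzk⟩
    · exact ⟨_, hrevg, hrevran, 1, Or.inr rfl, hrevz⟩
    · exact ⟨_, hrevg, hrevran, 0, Or.inl rfl, hrevz⟩
  obtain ⟨v', hvg', hvc, k, hk, hzk⟩ := hrev
  refine ⟨Matrix.vecCons z v', ?_, by rw [← hvc, ← range_eq_image_vecCons]⟩
  rcases hk with rfl | rfl
  · refine Or.inl (gram_vecCons hD (aGram_symm 9) (hz.trans (aGram_diag 9 0).symm) ?_ fun i => ?_)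
    · rw [hvg']
      decide +kernel
    · rw [hzk]
      revert i
      decide +kernel
  · refine Or.inr (gram_vecCons hD (dGram_symm 9) (hz.trans (dGram_diag 9 0).symm) ?_ fun i => ?_)
    · rw [hvg']
      decide +kernel
    · rw [hzk]
      revert i
      decide +kernel

end Extensions

section Rigidity

variable {M : Type*} [AddCommGroup M] {D : M →ₗ[ℤ] M →ₗ[ℤ] ℤ}

/-- If the coweight of the node `k` has small enough order in the discriminant group, no Weyl
group element maps a base to its negative while preserving the node `k`. -/
theorem not_weyl_neg (hD : IsEvenNegDef D) {n : ℕ} {G : Matrix (Fin n) (Fin n) ℤ}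
    (hdet : G.det ≠ 0) {k : Fin n} {h : Fin n → ℤ} {N : ℤ}
    (hGh : G *ᵥ h = fun i => if i = k then -N else 0) (hN0 : N ≠ 0) (hN : ¬ N ∣ 2 * h k)
    {b : Fin n → M} (hb : gram D b = G) (hspan : Submodule.span ℤ (Set.range b) = ⊤)
    {w : M ≃ₗ[ℤ] M} (hw : w ∈ weyl D) {τ : Equiv.Perm (Fin n)} (hwb : ∀ i, w (b i) = -b (τ i))
    (hτ : ∀ i j, G (τ i) (τ j) = G i j) : τ k ≠ k := by
  intro hk
  have hτk : ∀ i, τ i = k ↔ i = k := fun i => by rw [← τ.apply_eq_iff_eq (x := i), hk]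
  have hh : ∀ i, h (τ i) = h i := comp_perm_eq hdet hτ hGh fun i => by simp only [hτk]
  set x : M := ∑ i, h i • b i with hx
  have hwx : w x = -x := by
    have h1 : w x = -∑ i, h (τ i) • b (τ i) := by
      rw [hx, map_sum, ← Finset.sum_neg_distrib]
      refine Finset.sum_congr rfl fun i _ => ?_
      rw [map_zsmul, hwb, hh, smul_neg]
    rw [h1, Equiv.sum_comp τ fun i => h i • b i]
  have hxb : ∀ j, D x (b j) = if j = k then -N else 0 := fun j => by
    rw [hx, dual_eq_gram_mulVec hD, hb, hGh]
  have hdvd : ∀ y, N ∣ D x y := by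
    intro y
    obtain ⟨v, rfl⟩ := mem_span_range (hspan ▸ Submodule.mem_top : y ∈ Submodule.span ℤ (Set.range b))
    rw [sum_dual]
    refine Finset.dvd_sum fun i _ => Dvd.dvd.mul_left ?_ _
    rw [hxb]
    split_ifs
    · exact (dvd_refl N).neg_right
    · exact dvd_zero N
  have hxx : D x x = -(N * h k) := by
    conv_lhs => rw [hx, sum_dual]
    simp only [← hx, hxb, mul_ite, mul_zero, Finset.sum_ite_eq', Finset.mem_univ, if_true]
    ring
  obtain ⟨y, hy⟩ := weyl_congr_mod N hw x hdvd
  obtain ⟨m, hm⟩ := hdvd y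
  have h2 : D x (w x) = D x x + N * D x y := by
    rw [hy, map_add, map_zsmul, smul_eq_mul]
  rw [hwx, map_neg, hm, hxx] at h2
  refine hN ⟨m, mul_left_cancel₀ hN0 ?_⟩
  linear_combination h2

theorem isSimpleFamily_neg {ι : Type*} {b : ι → M} (hb : IsSimpleFamily D b) :
    IsSimpleFamily D fun i => -b i where
  root i := by simpa using hb.root i
  nonneg i j hij := by simpa using hb.nonneg i j hij
  li := hb.li.map' (LinearEquiv.neg ℤ).toLinearMap (LinearEquiv.ker _)

theorem isSimpleFamily_comp {ι κ : Type*} {b : ι → M} (hb : IsSimpleFamily D b) {φ : κ → ι}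
    (hφ : Function.Injective φ) : IsSimpleFamily D (b ∘ φ) where
  root _ := hb.root _
  nonneg _ _ hij := hb.nonneg _ _ (hφ.ne hij)
  li := hb.li.comp φ hφ

theorem span_range_neg {ι : Type*} (b : ι → M) :
    Submodule.span ℤ (Set.range fun i => -b i) = Submodule.span ℤ (Set.range b) := by
  have h : (Set.range fun i => -b i) = -Set.range b := by
    ext x
    simp [neg_eq_iff_eq_neg]
  rw [h, Submodule.span_neg]

theorem exists_weyl_image_compl (hD : IsEvenNegDef D) {n : ℕ} {G : Matrix (Fin n) (Fin n) ℤ}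
    (hdiag : ∀ i, G i i = -2) (hoff : ∀ i j, i ≠ j → 0 ≤ G i j) (hdet : G.det ≠ 0)
    {k l : Fin n} {g : Fin n → ℤ} {t : ℤ} (hGg : G *ᵥ g = fun _ => t)
    (hg : ∀ i, g i = g k → i = k ∨ i = l) {h : Fin n → ℤ} {N : ℤ}
    (hGh : G *ᵥ h = fun i => if i = k then -N else 0) (hN0 : N ≠ 0) (hN : ¬ N ∣ 2 * h k)
    {b b' : Fin n → M} (hb : gram D b = G) (hb' : gram D b' = G)
    (hspan : Submodule.span ℤ (Set.range b) = ⊤) (hspan' : Submodule.span ℤ (Set.range b') = ⊤) :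
    ∃ w ∈ weyl D, (fun x => w x) '' (b '' {k}ᶜ) = b' '' {k}ᶜ := by
  have hbs := isSimpleFamily_of_gram hD hdiag hoff hdet hb
  have hbs' := isSimpleFamily_of_gram hD hdiag hoff hdet hb'
  have himage : ∀ {σ : Equiv.Perm (Fin n)}, σ k = k → σ '' {k}ᶜ = {k}ᶜ := fun {σ} hσ => by
    rw [Set.image_compl_eq σ.bijective, Set.image_singleton, hσ]
  obtain ⟨w, hw, σ, hwσ, hσ⟩ := exists_weyl_perm hD hbs hbs' (hb.trans hb'.symm)
    (hspan.trans hspan'.symm)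
  rw [hb'] at hσ
  have hgσ := comp_perm_eq hdet hσ hGg fun _ => rfl
  by_cases hσk : σ k = k
  · refine ⟨w, hw, ?_⟩
    rw [Set.image_image]
    simp only [hwσ]
    rw [← Set.image_image b' σ, himage hσk]
  have hσl : σ k = l := (hg _ (hgσ k)).resolve_left hσk
  obtain ⟨w', hw', τ, hwτ, hτ⟩ := exists_weyl_perm hD (isSimpleFamily_neg hbs') hbs'
    (by ext i j; simp [gram]) ((span_range_neg b').trans rfl)
  rw [hb'] at hτ
  have hgτ := comp_perm_eq hdet hτ hGg fun _ => rfl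
  have hwτ' : ∀ i, w' (b' i) = -b' (τ i) := fun i => by
    rw [← hwτ i, map_neg, neg_neg]
  have hτk := not_weyl_neg hD hdet hGh hN0 hN hb' hspan' hw' hwτ' hτ
  have hτl : τ k = l := (hg _ (hgτ k)).resolve_left hτk
  have hτσ : τ (σ k) = k := by
    rw [hσl]
    refine (hg (τ l) ?_).resolve_right fun h => hσk ?_
    · rw [hgτ, ← hσl, hgσ]
    · rw [hσl]
      exact τ.injective (h.trans hτl.symm)
  set φ : {i : Fin n // i ≠ k} → Fin n := Subtype.val with hφ
  have hφr : ∀ c : Fin n → M, Set.range (c ∘ φ) = c '' {k}ᶜ := fun c => by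
    rw [Set.range_comp, hφ, Subtype.range_coe_subtype]
    rfl
  have hcs := isSimpleFamily_comp hbs' (φ := φ) Subtype.val_injective
  obtain ⟨w'', hw'', hran⟩ := exists_weyl_range_eq hD (isSimpleFamily_neg hcs) hcs
    (span_range_neg _)
  refine ⟨w'' * (w' * w), mul_mem hw'' (mul_mem hw' hw), ?_⟩
  rw [← hφr b', ← hran]
  ext x
  simp only [Set.mem_image, Set.mem_range, LinearEquiv.mul_apply]
  constructor
  · rintro ⟨_, ⟨i, hi, rfl⟩, rfl⟩
    refine ⟨⟨τ (σ i), fun h => hi (σ.injective (τ.injective (h.trans hτσ.symm)))⟩, ?_⟩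
    rw [hwσ, hwτ']
    rfl
  · rintro ⟨⟨i, hi⟩, rfl⟩
    refine ⟨_, ⟨σ.symm (τ.symm i), fun h => hi ?_, rfl⟩, ?_⟩
    · rw [← Set.mem_singleton_iff.mp h, Equiv.apply_symm_apply, Equiv.apply_symm_apply] at hτσ
      rw [hτσ]
      exact Set.mem_singleton_iff.mp h
    · rw [hwσ, hwτ', Equiv.apply_symm_apply, Equiv.apply_symm_apply]
      rfl

theorem exists_weyl_image_compl_A9 (hD : IsEvenNegDef D) {b b' : Fin 9 → M}
    (hb : gram D b = aGram 9) (hb' : gram D b' = aGram 9)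
    (hspan : Submodule.span ℤ (Set.range b) = ⊤) (hspan' : Submodule.span ℤ (Set.range b') = ⊤) :
    ∃ w ∈ weyl D, (fun x => w x) '' (b '' {0}ᶜ) = b' '' {0}ᶜ := by
  refine exists_weyl_image_compl hD (aGram_diag 9) (fun _ _ => aGram_nonneg 9)
    (by rw [det_aGram_nine]; decide) (l := 8) (g := ![9, 16, 21, 24, 25, 24, 21, 16, 9]) (t := -2)
    ?_ ?_ (h := ![9, 8, 7, 6, 5, 4, 3, 2, 1]) (N := 10) ?_ (by decide) (by decide)
    hb hb' hspan hspan' <;> decide +kernel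

theorem exists_weyl_image_compl_D9 (hD : IsEvenNegDef D) {b b' : Fin 9 → M}
    (hb : gram D b = dGram 9) (hb' : gram D b' = dGram 9)
    (hspan : Submodule.span ℤ (Set.range b) = ⊤) (hspan' : Submodule.span ℤ (Set.range b') = ⊤) :
    ∃ w ∈ weyl D, (fun x => w x) '' (b '' {0}ᶜ) = b' '' {0}ᶜ := by
  refine exists_weyl_image_compl hD (dGram_diag 9) (fun _ _ => dGram_nonneg 9)
    (by rw [det_dGram_nine]; decide) (l := 1) (g := ![18, 18, 35, 33, 30, 26, 21, 15, 8]) (t := -1)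
    ?_ ?_ (h := ![9, 7, 14, 12, 10, 8, 6, 4, 2]) (N := 4) ?_ (by decide) (by decide)
    hb hb' hspan hspan' <;> decide +kernel

end Rigidity

section Configurations

variable {M : Type*} [AddCommGroup M] {D : M →ₗ[ℤ] M →ₗ[ℤ] ℤ}

theorem isEvenNegDef_of_roots (hsymm : ∀ x y : M, D x y = D y x)
    (hneg : ∀ x : M, x ≠ 0 → D x x < 0)
    (hroot : Submodule.span ℤ {r : M | D r r = -2} = ⊤) : IsEvenNegDef D where
  symm := hsymm
  neg := hneg
  even x := by
    have hx : x ∈ Submodule.span ℤ {r : M | D r r = -2} := hroot ▸ Submodule.mem_top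
    induction hx using Submodule.span_induction with
    | mem r hr => exact ⟨-1, (show D r r = -2 from hr).trans (by decide)⟩
    | zero => simp
    | add x y _ _ hx hy =>
      have : D (x + y) (x + y) = D x x + D y y + 2 * D x y := by
        simp only [map_add, LinearMap.add_apply, hsymm y x]
        ring
      rw [this]
      exact (hx.add hy).add (even_two_mul _)
    | smul a x _ hx =>
      simp only [map_smul, LinearMap.smul_apply, smul_eq_mul]
      exact (hx.mul_left a).mul_left a

theorem isSimpleFamily_coe {C : Set M} (hroots : ∀ x ∈ C, D x x = -2)
    (hprod : ∀ x ∈ C, ∀ y ∈ C, x ≠ y → D x y = 0 ∨ D x y = 1)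
    (hli : LinearIndependent ℤ (fun x : C => (x : M))) :
    IsSimpleFamily D (fun x : C => (x : M)) where
  root i := hroots i i.2
  nonneg i j hij := by
    rcases hprod i i.2 j j.2 (fun h => hij (Subtype.ext h)) with h | h <;> simp [h]
  li := hli

theorem isConnectedFamily_coe {C : Set M}
    (hconn : ∀ x ∈ C, ∀ y ∈ C,
      Relation.ReflTransGen (fun a b : M => a ∈ C ∧ b ∈ C ∧ a ≠ b ∧ D a b ≠ 0) x y) :
    IsConnectedFamily D (fun x : C => (x : M)) := by
  rintro P ⟨i, hi⟩ hP j
  have h : ∀ y, Relation.ReflTransGen (fun a b : M => a ∈ C ∧ b ∈ C ∧ a ≠ b ∧ D a b ≠ 0) i y →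
      ∃ hy : y ∈ C, P ⟨y, hy⟩ := by
    intro y hy
    induction hy with
    | refl => exact ⟨i.2, hi⟩
    | tail _ hbc ih =>
      obtain ⟨hb, hPb⟩ := ih
      exact ⟨hbc.2.1, hP ⟨_, hb⟩ ⟨_, hbc.2.1⟩ hPb (fun h => hbc.2.2.1 (congrArg Subtype.val h))
        hbc.2.2.2⟩
  exact (h j (hconn i i.2 j j.2)).2

/-- A sublattice isometric to the whole lattice is the whole lattice. -/
theorem SubIsometric.eq_top [Module.Free ℤ M] [Module.Finite ℤ M] (hD : IsEvenNegDef D)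
    {S : Submodule ℤ M} (h : SubIsometric D ⊤ S) : S = ⊤ := by
  have hspan := (Module.finBasis ℤ M).span_eq
  obtain ⟨b, hb, hbg⟩ := SubIsometric.exists_family h (Module.finBasis ℤ M) hspan
  rw [← hb, ← hspan]
  refine (span_eq_of_det_gram_eq (fun i => hspan ▸ Submodule.mem_top) (by rw [hbg]) ?_).symm
  exact gram_det_ne_zero hD _ (Module.finBasis ℤ M).linearIndependent

theorem finrank_eq_of_gram [Module.Free ℤ M] [Module.Finite ℤ M] (hD : IsEvenNegDef D) {n : ℕ}
    {b : Fin n → M} (hdet : (gram D b).det ≠ 0) (hspan : Submodule.span ℤ (Set.range b) = ⊤) :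
    Module.finrank ℤ M = n := by
  rw [finrank_eq_card (li_of_gram_det_ne_zero hD b hdet) fun x =>
    ⟨1, one_ne_zero, hspan ▸ Submodule.mem_top⟩, Fintype.card_fin]

theorem gram_eq_aGram_nine {m b : Fin 9 → M} (hm : gram D m = aGram 9)
    (hspan : Submodule.span ℤ (Set.range m) = ⊤) (hb : gram D b = aGram 9 ∨ gram D b = dGram 9) :
    gram D b = aGram 9 ∧ Submodule.span ℤ (Set.range b) = ⊤ := by
  have hmem : ∀ i, b i ∈ Submodule.span ℤ (Set.range m) := fun i => hspan ▸ Submodule.mem_top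
  rcases hb with hb | hb
  · refine ⟨hb, ?_⟩
    rw [← hspan]
    exact (span_eq_of_det_gram_eq hmem (by rw [hb, hm]) (by rw [hm, det_aGram_nine]; decide)).symm
  · obtain ⟨p, hp, -⟩ := exists_det_gram_eq hmem
    rw [hb, hm, det_aGram_nine, det_dGram_nine] at hp
    omega

theorem gram_eq_dGram_nine {m b : Fin 9 → M} (hm : gram D m = dGram 9)
    (hspan : Submodule.span ℤ (Set.range m) = ⊤) (hb : gram D b = aGram 9 ∨ gram D b = dGram 9) :
    gram D b = dGram 9 ∧ Submodule.span ℤ (Set.range b) = ⊤ := by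
  have hmem : ∀ i, b i ∈ Submodule.span ℤ (Set.range m) := fun i => hspan ▸ Submodule.mem_top
  rcases hb with hb | hb
  · obtain ⟨p, hp, -⟩ := exists_det_gram_eq hmem
    rw [hb, hm, det_aGram_nine, det_dGram_nine] at hp
    omega
  · refine ⟨hb, ?_⟩
    rw [← hspan]
    exact (span_eq_of_det_gram_eq hmem (by rw [hb, hm]) (by rw [hm, det_dGram_nine]; decide)).symm

end Configurations
end RootLattice

open RootLattice in
/-- Let `Q = (M, D)` be an irreducible negative definite root lattice of
rank at most `9`. For `i = 1, 2` let `Cᵢ ⊆ Q` be a connected ADE configuration of roots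
spanning `Qᵢ` with primitive closure `Qᵢ'`. Assume `Q₁ ≅ Q₂`, `Q₁' ≅ Q₂'` and one of:
(1) `Q₁ = Q`; (2) `Q₁ ≠ Q₁' = Q`; (3) `Q₁ ≅ A₇`, `Q₁' ≅ E₇`, `Q ≅ E₈`;
(4) `Q₁ ≅ A₈`, `Q ≅ A₉`; (5) `Q₁ ≅ A₈`, `Q ≅ D₉`. Then some element of the Weyl group
`W(Q)` maps `C₁` onto `C₂`. -/
theorem root_sublattices_orbits (M : Type*) [AddCommGroup M] [Module ℤ M]
    [Module.Free ℤ M] [Module.Finite ℤ M]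
    (D : M →ₗ[ℤ] M →ₗ[ℤ] ℤ) (hsymm : ∀ x y : M, D x y = D y x)
    (hnegdef : ∀ x : M, x ≠ 0 → D x x < 0)
    (hroot : (⊤ : Submodule ℤ M) = Submodule.span ℤ {r : M | D r r = -2})
    (hirr : ¬ ∃ S T : Set M, S ∪ T = {r : M | D r r = -2} ∧ S.Nonempty ∧ T.Nonempty ∧
        S ∩ T = ∅ ∧ ∀ s ∈ S, ∀ t ∈ T, D s t = 0)
    (hrank : Module.finrank ℤ M ≤ 9)
    (C₁ C₂ : Set M)
    (hroots₁ : ∀ x ∈ C₁, D x x = -2) (hroots₂ : ∀ x ∈ C₂, D x x = -2)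
    (hprod₁ : ∀ x ∈ C₁, ∀ y ∈ C₁, x ≠ y → D x y = 0 ∨ D x y = 1)
    (hprod₂ : ∀ x ∈ C₂, ∀ y ∈ C₂, x ≠ y → D x y = 0 ∨ D x y = 1)
    (hli₁ : LinearIndependent ℤ (fun x : C₁ => (x : M)))
    (hli₂ : LinearIndependent ℤ (fun x : C₂ => (x : M)))
    (hconn₁ : C₁.Nonempty ∧ ∀ x ∈ C₁, ∀ y ∈ C₁,
      Relation.ReflTransGen (fun a b : M => a ∈ C₁ ∧ b ∈ C₁ ∧ a ≠ b ∧ D a b ≠ 0) x y)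
    (hconn₂ : C₂.Nonempty ∧ ∀ x ∈ C₂, ∀ y ∈ C₂,
      Relation.ReflTransGen (fun a b : M => a ∈ C₂ ∧ b ∈ C₂ ∧ a ≠ b ∧ D a b ≠ 0) x y)
    (Q₁' Q₂' : Submodule ℤ M)
    (hQ₁' : ∀ x : M, x ∈ Q₁' ↔ ∃ c : ℤ, c ≠ 0 ∧ c • x ∈ Submodule.span ℤ C₁)
    (hQ₂' : ∀ x : M, x ∈ Q₂' ↔ ∃ c : ℤ, c ≠ 0 ∧ c • x ∈ Submodule.span ℤ C₂)
    (hisoQ : SubIsometric D (Submodule.span ℤ C₁) (Submodule.span ℤ C₂))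
    (hisoQ' : SubIsometric D Q₁' Q₂')
    (hcase :
      Submodule.span ℤ C₁ = ⊤ ∨
      (Submodule.span ℤ C₁ ≠ Q₁' ∧ Q₁' = ⊤) ∨
      (IsoToGram D (Submodule.span ℤ C₁) 7 (aGram 7) ∧ IsoToGram D Q₁' 7 (eGram 7) ∧
        IsoToGram D ⊤ 8 (eGram 8)) ∨
      (IsoToGram D (Submodule.span ℤ C₁) 8 (aGram 8) ∧ IsoToGram D ⊤ 9 (aGram 9)) ∨
      (IsoToGram D (Submodule.span ℤ C₁) 8 (aGram 8) ∧ IsoToGram D ⊤ 9 (dGram 9))) :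
    ∃ w : M ≃ₗ[ℤ] M,
      w ∈ Subgroup.closure
        {f : M ≃ₗ[ℤ] M | ∃ r : M, D r r = -2 ∧ ∀ x : M, f x = x + D x r • r} ∧
      (fun x : M => w x) '' C₁ = C₂ := by
  obtain rfl : ‹Module ℤ M› = AddCommGroup.toIntModule M := Subsingleton.elim _ _
  change ∃ w : M ≃ₗ[ℤ] M, w ∈ weyl D ∧ (fun x : M => w x) '' C₁ = C₂
  have hD := isEvenNegDef_of_roots hsymm hnegdef hroot.symm
  have := (LinearIndependent.setFinite hli₁).fintype
  have := (LinearIndependent.setFinite hli₂).fintype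
  set c₁ : C₁ → M := fun x => x with hc₁
  set c₂ : C₂ → M := fun x => x with hc₂
  have hs₁ : IsSimpleFamily D c₁ := isSimpleFamily_coe hroots₁ hprod₁ hli₁
  have hs₂ : IsSimpleFamily D c₂ := isSimpleFamily_coe hroots₂ hprod₂ hli₂
  have hcon₁ : IsConnectedFamily D c₁ := isConnectedFamily_coe hconn₁.2
  have hcon₂ : IsConnectedFamily D c₂ := isConnectedFamily_coe hconn₂.2
  have hr₁ : Set.range c₁ = C₁ := Subtype.range_coe
  have hr₂ : Set.range c₂ = C₂ := Subtype.range_coe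
  have hA9D9 : ∀ G : Matrix (Fin 9) (Fin 9) ℤ, (G = aGram 9 ∨ G = dGram 9) →
      IsoToGram D (Submodule.span ℤ C₁) 8 (aGram 8) → IsoToGram D ⊤ 9 G →
      ∃ w : M ≃ₗ[ℤ] M, w ∈ weyl D ∧ (fun x : M => w x) '' C₁ = C₂ := by
    intro G hG hA hM
    obtain ⟨a₁, ha₁, hg₁⟩ := exists_isoToGram_family hA
    obtain ⟨a₂, ha₂, hg₂⟩ := SubIsometric.exists_family hisoQ a₁ ha₁
    obtain ⟨m, hm, hgm⟩ := exists_isoToGram_family hM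
    have h9 : Module.finrank ℤ M = 9 := finrank_eq_of_gram hD
      (by rcases hG with rfl | rfl <;> simp [hgm, det_aGram_nine, det_dGram_nine]) hm
    obtain ⟨b₁, hb₁, hi₁⟩ :=
      exists_A9_or_D9 hD hroot.symm hirr h9 hs₁ hg₁ (ha₁.trans (by rw [hr₁]))
    obtain ⟨b₂, hb₂, hi₂⟩ :=
      exists_A9_or_D9 hD hroot.symm hirr h9 hs₂ (hg₂.trans hg₁) (ha₂.trans (by rw [hr₂]))
    rw [← hr₁, ← hr₂, hi₁, hi₂]
    rcases hG with rfl | rfl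
    · obtain ⟨hg₁', hb₁'⟩ := gram_eq_aGram_nine hgm hm hb₁
      obtain ⟨hg₂', hb₂'⟩ := gram_eq_aGram_nine hgm hm hb₂
      exact exists_weyl_image_compl_A9 hD hg₁' hg₂' hb₁' hb₂'
    · obtain ⟨hg₁', hb₁'⟩ := gram_eq_dGram_nine hgm hm hb₁
      obtain ⟨hg₂', hb₂'⟩ := gram_eq_dGram_nine hgm hm hb₂
      exact exists_weyl_image_compl_D9 hD hg₁' hg₂' hb₁' hb₂'
  rcases hcase with h | ⟨hne, h⟩ | ⟨hA, hE, hM⟩ | ⟨hA, hM⟩ | ⟨hA, hM⟩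
  · have h₂ : Submodule.span ℤ C₂ = ⊤ := SubIsometric.eq_top hD (h ▸ hisoQ)
    obtain ⟨w, hw, hwr⟩ := exists_weyl_range_eq hD hs₁ hs₂ (by rw [hr₁, hr₂, h, h₂])
    refine ⟨w, hw, ?_⟩
    rw [hr₂] at hwr
    rw [← hwr]
    exact Set.image_eq_range _ _
  · rw [h] at hne
    have h₂ : Q₂' = ⊤ := SubIsometric.eq_top hD (h ▸ hisoQ')
    have hne₂ : Submodule.span ℤ C₂ ≠ ⊤ := fun h' =>
      hne (SubIsometric.eq_top hD (h' ▸ subIsometric_symm hisoQ))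
    rw [← hr₁] at hne hisoQ hQ₁' ⊢
    rw [← hr₂] at hne₂ hisoQ hQ₂' ⊢
    exact exists_weyl_image_eq_of_saturated hD hroot.symm hs₁ hcon₁ hs₂ hcon₂ hne hne₂
      (fun x => (hQ₁' x).mp (h ▸ Submodule.mem_top))
      (fun x => (hQ₂' x).mp (h₂ ▸ Submodule.mem_top)) hisoQ
  · obtain ⟨a₁, ha₁, hg₁⟩ := exists_isoToGram_family hA
    obtain ⟨a₂, ha₂, hg₂⟩ := SubIsometric.exists_family hisoQ a₁ ha₁
    obtain ⟨q₁, hq₁, hgq₁⟩ := exists_isoToGram_family hE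
    obtain ⟨q₂, hq₂, hgq₂⟩ := SubIsometric.exists_family hisoQ' q₁ hq₁
    obtain ⟨m, hm, hgm⟩ := exists_isoToGram_family hM
    have h8 : Module.finrank ℤ M = 8 :=
      finrank_eq_of_gram hD (by rw [hgm, det_eGram_eight]; decide) hm
    obtain ⟨u₁, hu₁, hi₁, z₁, hz₁⟩ := exists_affE7_attached hD hroot.symm hirr h8 hs₁ hcon₁ hg₁
      (ha₁.trans (by rw [hr₁])) hgq₁
      (fun i => by rw [hr₁]; exact (hQ₁' _).mp (hq₁ ▸ Submodule.subset_span ⟨i, rfl⟩))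
      (by rw [hr₁, hq₁]; exact fun x hx => (hQ₁' x).mpr ⟨1, one_ne_zero, by rwa [one_smul]⟩)
    obtain ⟨u₂, hu₂, hi₂, z₂, hz₂⟩ := exists_affE7_attached hD hroot.symm hirr h8 hs₂ hcon₂
      (hg₂.trans hg₁) (ha₂.trans (by rw [hr₂])) (hgq₂.trans hgq₁)
      (fun i => by rw [hr₂]; exact (hQ₂' _).mp (hq₂ ▸ Submodule.subset_span ⟨i, rfl⟩))
      (by rw [hr₂, hq₂]; exact fun x hx => (hQ₂' x).mpr ⟨1, one_ne_zero, by rwa [one_smul]⟩)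
    obtain ⟨w, hw, hwu⟩ := exists_weyl_image_eq_of_affE7_attached hD h8 hu₁ hu₂ hz₁ hz₂
    exact ⟨w, hw, by rw [← hr₁, ← hr₂, hi₁, hi₂, image_eq_of_map_eq hwu]⟩
  · exact hA9D9 _ (Or.inl rfl) hA hM
  · exact hA9D9 _ (Or.inr rfl) hA hM
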